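/- arXiv:1107.4132 — 5 statements merged into one kernel-verified Lean document; each statement's English description precedes it below -/
import Mathlib

section
/- Let $n \ge 1$, $R > 0$, $M > 0$ and $0 < \rho \le 1$. Suppose $f : B_{2R} \subset \mathbb{R}^n \to \mathbb{R}$ is infinitely differentiable and satisfies $|\partial^\alpha f(x)| \le M\,|\alpha|!\,(\rho R)^{-|\alpha|}$ for every $x \in B_{2R}$ and every multi-index $\alpha \in \mathbb{N}^n$. Let $E \subset B_{R/2}$ be a Lebesgue measurable set with $|E| > 0$. Then there exist constants $N > 0$ and $\theta \in (0,1)$, depending only on $n$, $\rho$ and the ratio $|E|/|B_R|$, such that $\|f\|_{L^\infty(B_R)} \le N \left( \frac{1}{|E|} \int_E |f|\,dx \right)^{\theta} M^{1-\theta}$. -/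
open MeasureTheory Metric Set

/-- A set of reals of measure larger than `k * d` contains `k + 1` points that are `d`-separated. -/
lemma exists_separated_points {d : ℝ} (hd : 0 ≤ d) (k : ℕ) {F : Set ℝ} (hF : BddBelow F)
    (hvol : ENNReal.ofReal (k * d) < volume F) :
    ∃ t : ℕ → ℝ, (∀ i ≤ k, t i ∈ F) ∧
      ∀ i j : ℕ, i ≤ j → j ≤ k → ((j : ℝ) - i) * d ≤ t j - t i := by
  induction k generalizing F with
  | zero =>
    have hne : F.Nonempty := by
      rw [nonempty_iff_ne_empty]
      rintro rfl
      simp at hvol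
    obtain ⟨x, hx⟩ := hne
    refine ⟨fun _ => x, fun _ _ => hx, fun i j hij hj => ?_⟩
    obtain rfl : j = 0 := by omega
    obtain rfl : i = 0 := by omega
    simp
  | succ k ih =>
    obtain ⟨r, hr0, hr1, hr2⟩ := ENNReal.lt_iff_exists_real_btwn.1 hvol
    have hr : ((k + 1 : ℕ) : ℝ) * d < r := by
      by_contra! h
      exact absurd hr1 (not_lt.2 (ENNReal.ofReal_le_ofReal h))
    have hne : F.Nonempty := by
      rw [nonempty_iff_ne_empty]
      rintro rfl
      simp at hr2
    push_cast at hr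
    obtain ⟨t₀, ht₀, ht₀'⟩ := exists_lt_of_csInf_lt hne
      (show sInf F < sInf F + (r - (k + 1) * d) by linarith)
    have hcover : F ⊆ (F ∩ Ici (t₀ + d)) ∪ Ico (sInf F) (t₀ + d) := by
      intro x hx
      rcases le_or_gt (t₀ + d) x with h | h
      · exact Or.inl ⟨hx, h⟩
      · exact Or.inr ⟨csInf_le hF hx, h⟩
    have hle : volume F ≤ volume (F ∩ Ici (t₀ + d)) + ENNReal.ofReal (t₀ + d - sInf F) := by
      refine (measure_mono hcover).trans ((measure_union_le _ _).trans ?_)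
      rw [Real.volume_Ico]
    have hvol' : ENNReal.ofReal (k * d) < volume (F ∩ Ici (t₀ + d)) := by
      by_contra! h
      have h1 : volume F ≤ ENNReal.ofReal (k * d) + ENNReal.ofReal (t₀ + d - sInf F) :=
        hle.trans (by gcongr)
      rw [← ENNReal.ofReal_add (by positivity) (by linarith [csInf_le hF ht₀])] at h1
      exact absurd (hr2.trans_le (h1.trans (ENNReal.ofReal_le_ofReal (by linarith)))) (lt_irrefl _)
    obtain ⟨t, ht, htd⟩ := ih (hF.mono inter_subset_left) hvol'
    refine ⟨fun i => if i = 0 then t₀ else t (i - 1), fun i hi => ?_, fun i j hij hj => ?_⟩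
    · by_cases h : i = 0
      · simpa [h] using ht₀
      · simpa [h] using (ht (i - 1) (by omega)).1
    · rcases i with _ | i
      · rcases j with _ | j
        · simp
        · have h1 := htd 0 j (by omega) (by omega)
          have h2 : t₀ + d ≤ t 0 := (ht 0 (by omega)).2
          simp only [Nat.cast_zero, sub_zero] at h1
          simp
          linarith
      · rcases j with _ | j
        · omega
        · have h1 := htd i j (by omega) (by omega)
          simpa using h1

/-- The product of the distances from `i` to the other points of `{0, …, k}`. -/
lemma prod_abs_sub_erase {i k : ℕ} (hik : i ≤ k) :
    ∏ j ∈ (Finset.range (k + 1)).erase i, |(i : ℝ) - j| = (i.factorial : ℝ) * (k - i).factorial := by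
  induction k, hik using Nat.le_induction with
  | base =>
    have h : (Finset.range (i + 1)).erase i = Finset.range i := by
      ext x; simp; omega
    rw [h, Nat.sub_self, ← Finset.prod_range_reflect]
    simp only [Nat.factorial_zero, Nat.cast_one, mul_one]
    rw [← Finset.prod_range_add_one_eq_factorial, Nat.cast_prod]
    refine Finset.prod_congr rfl fun j hj => ?_
    rw [Finset.mem_range] at hj
    have h1 : i - 1 - j = i - (j + 1) := by omega
    rw [h1, Nat.cast_sub (by omega)]
    push_cast
    rw [abs_of_nonneg (by linarith [(Nat.cast_nonneg j : (0 : ℝ) ≤ j)])]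
    ring
  | succ k hik ih =>
    have h : (Finset.range (k + 1 + 1)).erase i
        = insert (k + 1) ((Finset.range (k + 1)).erase i) := by
      ext x; simp; omega
    rw [h, Finset.prod_insert (by simp), ih, Nat.succ_sub hik, Nat.factorial_succ]
    have h1 : (i : ℝ) ≤ k := by exact_mod_cast hik
    rw [abs_of_nonpos (by push_cast; linarith)]
    push_cast [Nat.cast_sub hik]
    ring

/-- A Remez-type inequality on an interval. -/
lemma abs_eval_le_of_le_on_measurable {a L δ B : ℝ} (hL : 0 < L) (hδ : 0 < δ) (hB : 0 ≤ B)
    {k : ℕ} {P : Polynomial ℝ} (hP : P.natDegree ≤ k) {F : Set ℝ} (hFJ : F ⊆ Icc a (a + L))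
    (hF : ENNReal.ofReal (δ * L) ≤ volume F) (hPF : ∀ s ∈ F, |P.eval s| ≤ B)
    {x : ℝ} (hx : x ∈ Icc a (a + L)) :
    |P.eval x| ≤ (12 / δ) ^ k * B := by
  rcases Nat.eq_zero_or_pos k with rfl | hk
  · have hne : F.Nonempty := by
      rw [nonempty_iff_ne_empty]
      rintro rfl
      simp only [measure_empty, nonpos_iff_eq_zero, ENNReal.ofReal_eq_zero] at hF
      nlinarith [mul_pos hδ hL]
    obtain ⟨s, hs⟩ := hne
    have h := hPF s hs
    rw [Polynomial.eq_C_of_natDegree_le_zero hP] at h ⊢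
    simpa using h
  have hk' : (0 : ℝ) < k := by exact_mod_cast hk
  set d : ℝ := δ * L / (2 * k) with hd
  have hd0 : 0 < d := by positivity
  obtain ⟨t, htF, htd⟩ := exists_separated_points hd0.le k (F := F) ⟨a, fun y hy => (hFJ hy).1⟩ (by
    refine lt_of_lt_of_le ((ENNReal.ofReal_lt_ofReal_iff (by positivity)).2 ?_) hF
    rw [hd]
    field_simp
    linarith)
  have hsep : ∀ i ≤ k, ∀ j ≤ k, |(i : ℝ) - j| * d ≤ |t i - t j| := by
    intro i hi j hj
    rcases le_total i j with h | h
    · have h1 := htd i j h hj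
      have h2 : (i : ℝ) ≤ j := by exact_mod_cast h
      rw [abs_sub_comm (t i), abs_sub_comm (i : ℝ), abs_of_nonneg (sub_nonneg.2 h2)]
      exact h1.trans (le_abs_self _)
    · have h1 := htd j i h hi
      have h2 : (j : ℝ) ≤ i := by exact_mod_cast h
      rw [abs_of_nonneg (sub_nonneg.2 h2)]
      exact h1.trans (le_abs_self _)
  have hinj : Set.InjOn t (Finset.range (k + 1) : Finset ℕ) := by
    intro i hi j hj hij
    simp only [Finset.coe_range, mem_Iio] at hi hj
    have h := hsep i (by omega) j (by omega)
    rw [hij, sub_self, abs_zero] at h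
    have h1 : |(i : ℝ) - j| = 0 :=
      le_antisymm (by_contra fun hh => by nlinarith [not_le.1 hh]) (abs_nonneg _)
    have h2 : (i : ℝ) = j := sub_eq_zero.1 (abs_eq_zero.1 h1)
    exact_mod_cast h2
  have hdeg : P.degree < (Finset.range (k + 1)).card := by
    rw [Finset.card_range]
    exact lt_of_le_of_lt Polynomial.degree_le_natDegree (by exact_mod_cast Nat.lt_succ_of_le hP)
  have hint := Lagrange.eq_interpolate hinj hdeg
  have hbasis : ∀ i ∈ Finset.range (k + 1),
      |(Lagrange.basis (Finset.range (k + 1)) t i).eval x|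
        ≤ (L / d) ^ k / ((i.factorial : ℝ) * (k - i).factorial) := by
    intro i hi
    have hik : i ≤ k := Nat.lt_succ_iff.1 (Finset.mem_range.1 hi)
    rw [Lagrange.basis, Polynomial.eval_prod, Finset.abs_prod, ← prod_abs_sub_erase hik]
    have hcard : ((Finset.range (k + 1)).erase i).card = k := by
      rw [Finset.card_erase_of_mem hi, Finset.card_range]; rfl
    calc _ ≤ ∏ j ∈ (Finset.range (k + 1)).erase i, (L / d) * |(i : ℝ) - j|⁻¹ := by
          refine Finset.prod_le_prod (fun _ _ => abs_nonneg _) fun j hj => ?_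
          have hjk : j ≤ k := Nat.lt_succ_iff.1 (Finset.mem_range.1 (Finset.mem_of_mem_erase hj))
          have hji : (i : ℝ) - j ≠ 0 := by
            rw [sub_ne_zero]
            exact_mod_cast (Finset.ne_of_mem_erase hj).symm
          have hpos : 0 < |(i : ℝ) - j| := abs_pos.2 hji
          have h1 : |x - t j| ≤ L := by
            have := hFJ (htF j hjk)
            rw [abs_le]
            constructor <;> linarith [hx.1, hx.2, this.1, this.2]
          simp only [Lagrange.basisDivisor, Polynomial.eval_mul, Polynomial.eval_C,
            Polynomial.eval_sub, Polynomial.eval_X]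
          rw [abs_mul, abs_inv]
          calc |t i - t j|⁻¹ * |x - t j| ≤ (|(i : ℝ) - j| * d)⁻¹ * L := by
                gcongr
                exact hsep i hik j hjk
            _ = _ := by field_simp
      _ = _ := by
          rw [Finset.prod_mul_distrib, Finset.prod_const, hcard, Finset.prod_inv_distrib]
          exact (div_eq_mul_inv _ _).symm
  rw [hint, Lagrange.interpolate_apply, Polynomial.eval_finsetSum]
  have hLd : L / d = 2 * k / δ := by
    rw [hd]; field_simp
  calc _ ≤ ∑ i ∈ Finset.range (k + 1),
        |(Polynomial.C (P.eval (t i)) * Lagrange.basis (Finset.range (k + 1)) t i).eval x| :=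
        Finset.abs_sum_le_sum_abs _ _
    _ ≤ ∑ i ∈ Finset.range (k + 1), B * ((L / d) ^ k / k.factorial * (k.choose i : ℝ)) := by
        refine Finset.sum_le_sum fun i hi => ?_
        have hik : i ≤ k := Nat.lt_succ_iff.1 (Finset.mem_range.1 hi)
        rw [Polynomial.eval_mul, Polynomial.eval_C, abs_mul]
        refine mul_le_mul (hPF _ (htF i hik)) ((hbasis i hi).trans_eq ?_) (abs_nonneg _) hB
        have h := Nat.choose_mul_factorial_mul_factorial hik
        have h' : (k.choose i : ℝ) * i.factorial * (k - i).factorial = k.factorial := by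
          exact_mod_cast h
        rw [← h']
        have h3 : (k.choose i : ℝ) ≠ 0 := by exact_mod_cast (Nat.choose_pos hik).ne'
        field_simp
    _ = (4 / δ) ^ k * ((k : ℝ) ^ k / k.factorial) * B := by
        rw [← Finset.mul_sum, ← Finset.mul_sum, ← Nat.cast_sum, Nat.sum_range_choose, hLd]
        push_cast
        have : (4 : ℝ) / δ = 2 * (2 / δ) := by ring
        rw [this, mul_pow, show 2 * (k : ℝ) / δ = (2 / δ) * k by ring, mul_pow]
        ring
    _ ≤ (4 / δ) ^ k * 3 ^ k * B := by
        gcongr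
        refine (Real.pow_div_factorial_le_exp k hk'.le k).trans ?_
        rw [show (k : ℝ) = k * 1 by ring, Real.exp_nat_mul]
        gcongr
        exact Real.exp_one_lt_three.le
    _ = _ := by
        rw [← mul_pow]; ring_nf

/-- Optimisation of `D ^ k * B + 2 * 2⁻¹ ^ k` over `k`. -/
lemma le_rpow_of_forall_le_pow {D B y : ℝ} (hD : 1 ≤ D) (hB : 0 ≤ B) (hB1 : B ≤ 1)
    (h : ∀ k : ℕ, y ≤ D ^ k * B + 2 * (1 / 2) ^ k) :
    y ≤ 6 * B ^ (Real.log 2 / Real.log (2 * D)) := by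
  have hlog2 : 0 < Real.log 2 := Real.log_pos (by norm_num)
  have hlogD : 0 < Real.log (2 * D) := Real.log_pos (by linarith)
  rcases hB.eq_or_lt with rfl | hB0
  · rw [Real.zero_rpow (by positivity), mul_zero]
    have ht : Filter.Tendsto (fun k : ℕ => 2 * (1 / 2 : ℝ) ^ k) Filter.atTop (nhds (2 * 0)) :=
      (tendsto_pow_atTop_nhds_zero_of_lt_one (by norm_num) (by norm_num)).const_mul 2
    rw [mul_zero] at ht
    exact ge_of_tendsto' ht fun k => by simpa using h k
  · obtain ⟨k, hk1, hk2⟩ := exists_nat_pow_near (show 1 ≤ B⁻¹ from (one_le_inv₀ hB0).2 hB1)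
      (show 1 < 2 * D by linarith)
    have h1 : D ^ k * B ≤ (1 / 2) ^ k := by
      have h3 : (2 * D) ^ k * B ≤ 1 := by
        calc (2 * D) ^ k * B ≤ B⁻¹ * B := by gcongr
          _ = 1 := inv_mul_cancel₀ hB0.ne'
      calc D ^ k * B = (1 / 2) ^ k * ((2 * D) ^ k * B) := by
            rw [← mul_assoc, ← mul_pow]; congr 2; ring
        _ ≤ (1 / 2) ^ k * 1 := by gcongr
        _ = _ := mul_one _
    have h2 : (1 / 2 : ℝ) ^ (k + 1) ≤ B ^ (Real.log 2 / Real.log (2 * D)) := by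
      have h3 : (2 : ℝ) = (2 * D) ^ (Real.log 2 / Real.log (2 * D)) := by
        rw [Real.rpow_def_of_pos (by linarith), mul_div_cancel₀ _ hlogD.ne', Real.exp_log (by norm_num)]
      have h4 : ((2 * D) ^ (k + 1))⁻¹ ≤ B := by
        rw [inv_le_comm₀ (by positivity) hB0]
        exact hk2.le
      calc (1 / 2 : ℝ) ^ (k + 1) = (((2 * D) ^ (k + 1))⁻¹) ^ (Real.log 2 / Real.log (2 * D)) := by
            rw [Real.inv_rpow (by positivity), ← Real.rpow_natCast (2 * D), ← Real.rpow_mul (by linarith),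
              mul_comm ((k + 1 : ℕ) : ℝ), Real.rpow_mul (by linarith), ← h3, Real.rpow_natCast, one_div, inv_pow]
        _ ≤ _ := by gcongr
    have h5 := h k
    rw [pow_succ] at h2
    linarith

/-- A function well approximated by polynomials on an interval is controlled there by its values
on a subset of positive measure. -/
lemma abs_le_rpow_of_polynomial_approx {a L δ B : ℝ} (hL : 0 < L) (hδ : 0 < δ) (hδ1 : δ ≤ 1)
    (hB : 0 ≤ B) {g : ℝ → ℝ} (hg : ∀ s ∈ Icc a (a + L), |g s| ≤ 1)
    (happ : ∀ k : ℕ, ∃ P : Polynomial ℝ, P.natDegree ≤ k ∧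
      ∀ s ∈ Icc a (a + L), |g s - P.eval s| ≤ (δ / 24) ^ (k + 1))
    {F : Set ℝ} (hFJ : F ⊆ Icc a (a + L))
    (hF : ENNReal.ofReal (δ * L) ≤ volume F) (hgF : ∀ s ∈ F, |g s| ≤ B) :
    ∀ s ∈ Icc a (a + L), |g s| ≤ 6 * B ^ (Real.log 2 / Real.log (2 * (12 / δ))) := by
  intro s hs
  have hD : 1 ≤ 12 / δ := by
    rw [one_le_div hδ]; linarith
  rcases lt_or_ge 1 B with hB1 | hB1
  · have h1 : 1 ≤ B ^ (Real.log 2 / Real.log (2 * (12 / δ))) :=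
      Real.one_le_rpow hB1.le (div_nonneg (Real.log_nonneg (by norm_num))
        (Real.log_nonneg (by linarith)))
    linarith [hg s hs]
  refine le_rpow_of_forall_le_pow hD hB hB1 fun k => ?_
  obtain ⟨P, hPk, hP⟩ := happ k
  have hq : (δ / 24) ^ (k + 1) ≤ (δ / 24) ^ k :=
    pow_le_pow_of_le_one (by positivity) (by linarith) (Nat.le_succ k)
  have hq2 : (12 / δ) ^ k * (δ / 24) ^ k = (1 / 2) ^ k := by
    rw [← mul_pow]
    congr 1
    field_simp
    norm_num
  have hq3 : (δ / 24) ^ k ≤ (1 / 2) ^ k := by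
    gcongr
    linarith
  have hPF : ∀ u ∈ F, |P.eval u| ≤ B + (δ / 24) ^ k := by
    intro u hu
    have h1 := hP u (hFJ hu)
    have h2 := hgF u hu
    have h3 := abs_sub_abs_le_abs_sub (P.eval u) (g u)
    rw [abs_sub_comm] at h3
    linarith
  have h4 := abs_eval_le_of_le_on_measurable hL hδ (by positivity) hPk hFJ hF hPF hs
  have h5 := abs_sub_abs_le_abs_sub (g s) (P.eval s)
  have h6 := hP s hs
  rw [mul_add, hq2] at h4
  linarith

/-- Propagation of smallness from a measurable subset of `[0, 1]` to the origin. -/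
lemma abs_zero_le_of_polynomial_approx {A δ B : ℝ} {K : ℕ} (hK : 0 < K) (hδ : 0 < δ)
    (hδ1 : δ ≤ 1 / 2) (hA : 0 ≤ A) (hAK : A * (2 / K) ≤ δ / 24) (hB : 0 ≤ B) (hB1 : B ≤ 1)
    {g : ℝ → ℝ} (hg : ∀ s ∈ Icc (0 : ℝ) 1, |g s| ≤ 1)
    (happ : ∀ a b : ℝ, 0 ≤ a → a < b → b ≤ 1 → ∀ k : ℕ, ∃ P : Polynomial ℝ, P.natDegree ≤ k ∧
      ∀ s ∈ Icc a b, |g s - P.eval s| ≤ (A * (b - a)) ^ (k + 1))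
    {F : Set ℝ} (hF01 : F ⊆ Icc 0 1) (hF : ENNReal.ofReal δ ≤ volume F)
    (hgF : ∀ s ∈ F, |g s| ≤ B) :
    |g 0| ≤ 6 ^ K * B ^ ((Real.log 2 / Real.log (2 * (12 / δ))) ^ K) := by
  set θ : ℝ := Real.log 2 / Real.log (2 * (12 / δ)) with hθ
  have hK0 : (0 : ℝ) < K := by exact_mod_cast hK
  have h12 : 2 < 2 * (12 / δ) := by
    have : 1 < 12 / δ := by rw [one_lt_div hδ]; linarith
    linarith
  have hlog2 : 0 < Real.log 2 := Real.log_pos (by norm_num)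
  have hθ0 : 0 < θ := div_pos hlog2 (Real.log_pos (by linarith))
  have hθ1 : θ < 1 := (div_lt_one (Real.log_pos (by linarith))).2
    (Real.log_lt_log (by norm_num) h12)
  have happ' : ∀ a L : ℝ, 0 ≤ a → 0 < L → a + L ≤ 1 → L ≤ 2 / K → ∀ k : ℕ, ∃ P : Polynomial ℝ,
      P.natDegree ≤ k ∧ ∀ s ∈ Icc a (a + L), |g s - P.eval s| ≤ (δ / 24) ^ (k + 1) := by
    intro a L ha hL haL hLK k
    obtain ⟨P, hPk, hP⟩ := happ a (a + L) ha (by linarith) haL k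
    refine ⟨P, hPk, fun s hs => (hP s hs).trans ?_⟩
    rw [add_sub_cancel_left]
    gcongr
    exact (mul_le_mul_of_nonneg_left hLK hA).trans hAK
  obtain ⟨j, hjK, hj⟩ : ∃ j ∈ Finset.range K, ENNReal.ofReal (δ * (1 / K))
      ≤ volume (F ∩ Icc ((j : ℝ) / K) (j / K + 1 / K)) := by
    by_contra! hlt
    refine absurd (ENNReal.sum_lt_sum_of_nonempty (Finset.nonempty_range_iff.2 hK.ne') hlt) ?_
    rw [not_lt, Finset.sum_const, Finset.card_range, ← ENNReal.ofReal_nsmul, nsmul_eq_mul]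
    rw [show (K : ℝ) * (δ * (1 / K)) = δ by field_simp]
    refine hF.trans (le_trans (measure_mono fun x hx => ?_) (measure_biUnion_finset_le _ _))
    have hx01 := hF01 hx
    simp only [mem_iUnion, Finset.mem_range]
    rcases hx01.2.eq_or_lt with h1 | h1
    · refine ⟨K - 1, by omega, hx, ?_⟩
      rw [Nat.cast_sub hK, ← add_div, h1, Nat.cast_one, sub_add_cancel, div_self hK0.ne']
      exact ⟨by rw [div_le_one hK0]; linarith, le_rfl⟩
    · refine ⟨⌊x * K⌋₊, ?_, hx, ?_⟩
      · rw [Nat.floor_lt (by have := hx01.1; positivity)]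
        nlinarith
      · rw [← add_div]
        constructor
        · rw [div_le_iff₀ hK0]
          exact Nat.floor_le (by have := hx01.1; positivity)
        · rw [le_div_iff₀ hK0]
          exact (Nat.lt_floor_add_one _).le
  rw [Finset.mem_range] at hjK
  have hcell : ∀ i : ℕ, i < K → (i : ℝ) / K + 1 / K ≤ 1 := by
    intro i hi
    rw [← add_div, div_le_one hK0]
    exact_mod_cast hi
  have hKle : 1 / (K : ℝ) ≤ 2 / K := by gcongr; norm_num
  have hg' : ∀ a L : ℝ, 0 ≤ a → a + L ≤ 1 → ∀ s ∈ Icc a (a + L), |g s| ≤ 1 :=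
    fun a L ha haL s hs => hg s ⟨ha.trans hs.1, hs.2.trans haL⟩
  have key : ∀ m : ℕ, m ≤ j → ∀ s ∈ Icc (((j - m : ℕ) : ℝ) / K) (((j - m : ℕ) : ℝ) / K + 1 / K),
      |g s| ≤ 6 ^ (m + 1) * B ^ (θ ^ (m + 1)) := by
    intro m
    induction m with
    | zero =>
      intro _ s hs
      simp only [zero_add, pow_one]
      exact abs_le_rpow_of_polynomial_approx (by positivity) hδ (by linarith) hB (hg' _ _ (by positivity) (hcell j hjK))
        (happ' _ _ (by positivity) (by positivity) (hcell j hjK) hKle)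
        inter_subset_right hj (fun u hu => hgF u hu.1) s hs
    | succ m ih =>
      intro hm s hs
      obtain ⟨i, hi⟩ : ∃ i, j - m = i + 1 := ⟨j - m - 1, by omega⟩
      have hi' : j - (m + 1) = i := by omega
      have ih' := ih (by omega)
      rw [hi] at ih'
      rw [hi'] at hs
      have hiK : i + 1 < K := by omega
      set b : ℝ := 6 ^ (m + 1) * B ^ (θ ^ (m + 1)) with hb
      have hb0 : 0 ≤ b := by positivity
      have hend : (i : ℝ) / K + 2 / K = ((i + 1 : ℕ) : ℝ) / K + 1 / K := by
        push_cast; ring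
      have hle1 : (i : ℝ) / K + 2 / K ≤ 1 := hend ▸ hcell (i + 1) hiK
      have hstart : (i : ℝ) / K ≤ ((i + 1 : ℕ) : ℝ) / K := by
        gcongr; exact Nat.le_succ i
      have hstep := abs_le_rpow_of_polynomial_approx (a := (i : ℝ) / K) (L := 2 / K)
        (F := Icc (((i + 1 : ℕ) : ℝ) / K) (((i + 1 : ℕ) : ℝ) / K + 1 / K))
        (by positivity) hδ (by linarith) hb0 (hg' _ _ (by positivity) hle1)
        (happ' _ _ (by positivity) (by positivity) hle1 le_rfl)
        (Icc_subset_Icc hstart hend.ge) (by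
          rw [Real.volume_Icc, add_sub_cancel_left]
          apply ENNReal.ofReal_le_ofReal
          rw [mul_div_assoc']
          gcongr
          linarith) ih' s ⟨hs.1, hs.2.trans (by linarith)⟩
      refine hstep.trans ?_
      have h6 : ((6 : ℝ) ^ (m + 1)) ^ θ ≤ 6 ^ (m + 1) := by
        conv_rhs => rw [← Real.rpow_one ((6 : ℝ) ^ (m + 1))]
        exact Real.rpow_le_rpow_of_exponent_le (one_le_pow₀ (by norm_num)) hθ1.le
      rw [hb, Real.mul_rpow (by positivity) (by positivity), ← Real.rpow_mul hB, ← pow_succ,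
        pow_succ' (6 : ℝ) (m + 1), mul_assoc]
      gcongr
  have h0 := key j le_rfl 0 (by simp)
  refine h0.trans ?_
  rcases hB.eq_or_lt with rfl | hB0
  · rw [Real.zero_rpow (by positivity), Real.zero_rpow (by positivity)]
    simp
  have hpow : θ ^ K ≤ θ ^ (j + 1) := pow_le_pow_of_le_one hθ0.le hθ1.le hjK
  refine mul_le_mul (pow_le_pow_right₀ (by norm_num) hjK) ?_ (by positivity) (by positivity)
  exact Real.rpow_le_rpow_of_exponent_ge hB0 hB1 hpow

/-- A smooth function with analytic-type derivative bounds is close to its Taylor polynomials. -/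
lemma exists_polynomial_approx {A M : ℝ} (hA : 0 ≤ A) (hM : 0 < M) {g : ℝ → ℝ} {U : Set ℝ}
    (hU : IsOpen U) (hg : ContDiffOn ℝ (⊤ : ℕ∞) g U)
    (hbound : ∀ k : ℕ, ∀ s ∈ U, |iteratedDerivWithin k g U s| ≤ M * k.factorial * A ^ k)
    {a b : ℝ} (hab : a < b) (hsub : Icc a b ⊆ U) (k : ℕ) :
    ∃ P : Polynomial ℝ, P.natDegree ≤ k ∧
      ∀ s ∈ Icc a b, |g s / M - P.eval s| ≤ (2 * A * (b - a)) ^ (k + 1) := by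
  have hderiv : ∀ y ∈ Icc a b, ‖iteratedDerivWithin (k + 1) g (Icc a b) y‖
      ≤ M * (k + 1).factorial * A ^ (k + 1) := by
    intro y hy
    have hgy : ContDiffAt ℝ ((k + 1 : ℕ) : WithTop ℕ∞) g y :=
      ((hg y (hsub hy)).contDiffAt (hU.mem_nhds (hsub hy))).of_le (by exact_mod_cast le_top)
    rw [iteratedDerivWithin_eq_iteratedDeriv (uniqueDiffOn_Icc hab) hgy hy,
      ← iteratedDerivWithin_of_isOpen hU (hsub hy), Real.norm_eq_abs]
    exact hbound _ _ (hsub hy)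
  refine ⟨∑ i ∈ Finset.range (k + 1),
    Polynomial.C ((i.factorial : ℝ)⁻¹ * iteratedDerivWithin i g (Icc a b) a / M)
      * (Polynomial.X - Polynomial.C a) ^ i, ?_, fun s hs => ?_⟩
  · refine Polynomial.natDegree_sum_le_of_forall_le _ _ fun i hi => ?_
    refine (Polynomial.natDegree_C_mul_le _ _).trans ?_
    rw [Polynomial.natDegree_pow, Polynomial.natDegree_X_sub_C, mul_one]
    exact Nat.lt_succ_iff.1 (Finset.mem_range.1 hi)
  · have hT := taylor_mean_remainder_bound hab.le
      ((hg.mono hsub).of_le (by exact_mod_cast le_top)) hs hderiv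
    have heval : (∑ i ∈ Finset.range (k + 1),
        Polynomial.C ((i.factorial : ℝ)⁻¹ * iteratedDerivWithin i g (Icc a b) a / M)
          * (Polynomial.X - Polynomial.C a) ^ i).eval s
        = taylorWithinEval g k (Icc a b) a s / M := by
      rw [taylor_within_apply, Polynomial.eval_finsetSum, Finset.sum_div]
      refine Finset.sum_congr rfl fun i _ => ?_
      simp only [Polynomial.eval_mul, Polynomial.eval_C, Polynomial.eval_pow, Polynomial.eval_sub,
        Polynomial.eval_X, smul_eq_mul]
      ring
    rw [heval, ← sub_div, abs_div, abs_of_pos hM, div_le_iff₀ hM]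
    rw [Real.norm_eq_abs] at hT
    have h2 : ((k : ℝ) + 1) ≤ 2 ^ (k + 1) := by
      exact_mod_cast (Nat.lt_two_pow_self (n := k + 1)).le
    have hsa : 0 ≤ s - a := by linarith [hs.1]
    calc _ ≤ _ := hT
      _ = M * A ^ (k + 1) * ((k + 1) * (s - a) ^ (k + 1)) := by
          rw [Nat.factorial_succ]
          push_cast
          have : (k.factorial : ℝ) ≠ 0 := by positivity
          field_simp
      _ ≤ M * A ^ (k + 1) * (2 ^ (k + 1) * (b - a) ^ (k + 1)) := by
          gcongr
          exact hs.2
      _ = _ := by rw [mul_pow, mul_pow]; ring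

open scoped Pointwise in
/-- The iterated derivatives of the restriction of a function to a line. -/
lemma iteratedDerivWithin_comp_line {V : Type*} [NormedAddCommGroup V] [NormedSpace ℝ V]
    {f : V → ℝ} {S : Set V} (hS : IsOpen S) (hf : ContDiffOn ℝ (⊤ : ℕ∞) f S) (x v : V) (k : ℕ)
    {s : ℝ} (hs : x + s • v ∈ S) :
    iteratedDerivWithin k (fun r : ℝ => f (x + r • v)) {r : ℝ | x + r • v ∈ S} s
      = iteratedFDerivWithin ℝ k f S (x + s • v) fun _ => v := by
  set W : Set V := {z | x + z ∈ S} with hW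
  have hWo : IsOpen W := hS.preimage (by fun_prop)
  have hfW : ContDiffOn ℝ (⊤ : ℕ∞) (fun z => f (x + z)) W :=
    hf.comp (by fun_prop) fun z hz => hz
  set ℓ : ℝ →L[ℝ] V := ContinuousLinearMap.toSpanSingleton ℝ v with hℓ
  have h1 := ℓ.iteratedFDerivWithin_comp_right hfW hWo.uniqueDiffOn
    (hWo.preimage ℓ.continuous).uniqueDiffOn (x := s) (i := k)
    (by simpa [hℓ, hW] using hs) (by exact_mod_cast le_top)
  have hWS : x +ᵥ W = S := by
    ext z
    simp [mem_vadd_set_iff_neg_vadd_mem, hW]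
  rw [iteratedFDerivWithin_comp_add_left, hWS] at h1
  have hcomp : (fun r : ℝ => f (x + r • v)) = (fun z => f (x + z)) ∘ ℓ := by
    ext r; simp [hℓ]
  have hpre : {r : ℝ | x + r • v ∈ S} = ℓ ⁻¹' W := by
    ext r; simp [hℓ, hW]
  rw [iteratedDerivWithin_eq_iteratedFDerivWithin, hcomp, hpre, h1]
  simp [hℓ]

/-- Bounds on coordinate directions bound a multilinear form on the diagonal. -/
lemma abs_apply_diag_le {n k : ℕ} {C : ℝ}
    (T : ContinuousMultilinearMap ℝ (fun _ : Fin k => EuclideanSpace ℝ (Fin n)) ℝ)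
    (hT : ∀ m : Fin k → Fin n, |T fun j => EuclideanSpace.single (m j) (1 : ℝ)| ≤ C)
    (v : EuclideanSpace ℝ (Fin n)) :
    |T fun _ => v| ≤ (∑ i, |v i|) ^ k * C := by
  have hv : v = ∑ i, v i • EuclideanSpace.single i (1 : ℝ) := by
    simpa using ((EuclideanSpace.basisFun (Fin n) ℝ).sum_repr v).symm
  have h1 : (T fun _ => v) = ∑ r : Fin k → Fin n,
      (∏ j, v (r j)) • T fun j => EuclideanSpace.single (r j) (1 : ℝ) := by
    conv_lhs => rw [hv]
    rw [T.map_sum (fun _ i => v i • EuclideanSpace.single i (1 : ℝ))]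
    refine Finset.sum_congr rfl fun r _ => ?_
    rw [T.map_smul_univ (fun j => v (r j)) fun j => EuclideanSpace.single (r j) (1 : ℝ)]
  rw [h1, Fintype.sum_pow, Finset.sum_mul]
  refine (Finset.abs_sum_le_sum_abs _ _).trans (Finset.sum_le_sum fun r _ => ?_)
  rw [smul_eq_mul, abs_mul, Finset.abs_prod]
  gcongr
  exact hT r

/-- From every point of a ball, some segment meets a given subset in a set of positive length. -/
lemma exists_segment_inter_measure {n : ℕ} (hn : 1 ≤ n) {R δ : ℝ} (hR : 0 < R) (hδ : 0 < δ)
    (hδ1 : δ ≤ 1) {E : Set (EuclideanSpace ℝ (Fin n))} (hE : MeasurableSet E)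
    (hER : E ⊆ ball 0 R)
    (hvol : ENNReal.ofReal δ * volume (ball (0 : EuclideanSpace ℝ (Fin n)) R) ≤ volume E)
    {x : EuclideanSpace ℝ (Fin n)} (hx : x ∈ ball (0 : EuclideanSpace ℝ (Fin n)) R) :
    ∃ y ∈ ball (0 : EuclideanSpace ℝ (Fin n)) R,
      ENNReal.ofReal (δ ^ 2 / (8 * n)) ≤ volume {s ∈ Icc (0 : ℝ) 1 | x + s • (y - x) ∈ E} := by
  set B : Set (EuclideanSpace ℝ (Fin n)) := ball 0 R with hB
  have hn0 : (0 : ℝ) < n := by exact_mod_cast hn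
  have hn1 : (1 : ℝ) ≤ n := by exact_mod_cast hn
  set η : ℝ := δ / (2 * n) with hη
  have hη0 : 0 < η := by positivity
  have hη1 : η ≤ 1 / 2 := by
    rw [hη, div_le_div_iff₀ (by positivity) (by norm_num)]; nlinarith
  have hB0 : volume B ≠ 0 := (measure_ball_pos _ _ hR).ne'
  have hBt : volume B ≠ ⊤ := measure_ball_lt_top.ne
  set β := (volume B).toReal with hβ
  have hβ0 : 0 < β := ENNReal.toReal_pos hB0 hBt
  have hvB : volume B = ENNReal.ofReal β := (ENNReal.ofReal_toReal hBt).symm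
  set T : Set (ℝ × EuclideanSpace ℝ (Fin n)) :=
    {p | p.1 ∈ Icc (1 - η) 1 ∧ p.2 ∈ B ∧ x + p.1 • (p.2 - x) ∈ E} with hT
  have hTm : MeasurableSet T := by
    refine (measurableSet_Icc.preimage measurable_fst).inter
      ((measurableSet_ball.preimage measurable_snd).inter (hE.preimage ?_))
    fun_prop
  have hslice : ∀ s ∈ Icc (1 - η) 1, ENNReal.ofReal (δ / 2 * β) ≤ volume (Prod.mk s ⁻¹' T) := by
    intro s hs
    have hs0 : 0 < s := by linarith [hs.1]
    set S := Prod.mk s ⁻¹' T with hS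
    set h := AffineMap.homothety x s with hh
    have happ : ∀ z, h z = x + s • (z - x) := fun z => by
      rw [hh, AffineMap.homothety_apply, vsub_eq_sub, vadd_eq_add, add_comm]
    have hpow : 1 - δ / 2 ≤ s ^ n := by
      have h1 := one_add_mul_le_pow (show (-2 : ℝ) ≤ s - 1 by linarith) n
      rw [add_sub_cancel] at h1
      have h2 : (n : ℝ) * (-η) ≤ n * (s - 1) := by
        apply mul_le_mul_of_nonneg_left _ hn0.le
        linarith [hs.1]
      have h3 : (n : ℝ) * η = δ / 2 := by rw [hη]; field_simp
      linarith
    have hpow1 : s ^ n ≤ 1 := pow_le_one₀ hs0.le hs.2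
    have himg : ∀ Z : Set (EuclideanSpace ℝ (Fin n)),
        volume (h '' Z) = ENNReal.ofReal (s ^ n) * volume Z := by
      intro Z
      rw [hh, Measure.addHaar_image_homothety, finrank_euclideanSpace_fin,
        abs_of_pos (pow_pos hs0 n)]
    have hhB : h '' B ⊆ B := by
      rintro _ ⟨z, hz, rfl⟩
      rw [happ]
      exact (convex_ball _ _).add_smul_sub_mem hx hz ⟨hs0.le, hs.2⟩
    have hcover : E ⊆ h '' S ∪ (B \ h '' B) := by
      intro z hz
      by_cases hzB : z ∈ h '' B
      · obtain ⟨w, hw, rfl⟩ := hzB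
        exact Or.inl ⟨w, ⟨hs, hw, by rwa [← happ]⟩, rfl⟩
      · exact Or.inr ⟨hER hz, hzB⟩
    have hhBm : NullMeasurableSet (h '' B) volume := by
      refine IsOpen.nullMeasurableSet ?_
      exact AffineMap.homothety_isOpenMap x s hs0.ne' B isOpen_ball
    have hdiff : volume (B \ h '' B) ≤ ENNReal.ofReal (δ / 2 * β) := by
      rw [measure_sdiff hhB hhBm (by rw [himg]; finiteness), himg, hvB,
        ← ENNReal.ofReal_mul (by positivity), ← ENNReal.ofReal_sub _ (by positivity)]
      apply ENNReal.ofReal_le_ofReal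
      nlinarith
    have h1 : volume E ≤ volume S + ENNReal.ofReal (δ / 2 * β) := by
      refine (measure_mono hcover).trans ((measure_union_le _ _).trans ?_)
      refine add_le_add ?_ hdiff
      rw [himg]
      calc _ ≤ ENNReal.ofReal 1 * volume S := by gcongr
        _ = _ := by simp
    have h2 := hvol.trans h1
    rw [hvB, ← ENNReal.ofReal_mul hδ.le, show δ * β = δ / 2 * β + δ / 2 * β by ring,
      ENNReal.ofReal_add (by positivity) (by positivity)] at h2
    exact (ENNReal.add_le_add_iff_right ENNReal.ofReal_ne_top).1 h2
  have hlow : ENNReal.ofReal (η * (δ / 2 * β)) ≤ (volume.prod volume) T := by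
    rw [Measure.prod_apply hTm]
    calc _ = ∫⁻ _ in Icc (1 - η) 1, ENNReal.ofReal (δ / 2 * β) := by
          rw [setLIntegral_const, Real.volume_Icc, ← ENNReal.ofReal_mul (by positivity)]
          congr 1
          ring
      _ ≤ ∫⁻ s in Icc (1 - η) 1, volume (Prod.mk s ⁻¹' T) :=
          setLIntegral_mono' measurableSet_Icc hslice
      _ ≤ _ := setLIntegral_le_lintegral _ _
  by_contra! hcon
  have hup : (volume.prod volume) T ≤ ENNReal.ofReal (δ ^ 2 / (8 * n)) * volume B := by
    rw [Measure.prod_apply_symm hTm]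
    calc _ ≤ ∫⁻ y, B.indicator (fun _ => ENNReal.ofReal (δ ^ 2 / (8 * n))) y := by
          refine lintegral_mono fun y => ?_
          by_cases hy : y ∈ B
          · rw [indicator_of_mem hy]
            refine (measure_mono ?_).trans (hcon y hy).le
            rintro s ⟨hs, _, hsE⟩
            exact ⟨⟨by linarith [hs.1], hs.2⟩, hsE⟩
          · rw [indicator_of_notMem hy]
            refine (measure_mono (t := ∅) ?_).trans (by simp)
            rintro s ⟨_, hs, _⟩
            exact hy hs
      _ = _ := by
          rw [lintegral_indicator measurableSet_ball, setLIntegral_const]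
  have h3 := hlow.trans hup
  rw [hvB, ← ENNReal.ofReal_mul (by positivity), ENNReal.ofReal_le_ofReal_iff (by positivity)] at h3
  have h4 : η * (δ / 2 * β) = 2 * (δ ^ 2 / (8 * n) * β) := by
    rw [hη]; field_simp; ring
  have h5 : 0 < δ ^ 2 / (8 * n) * β := by positivity
  linarith

/-- Chebyshev's inequality: a function is at most twice (a bound for) its mean on half of a set. -/
lemma half_measure_le_of_average_lt {V : Type*} [MeasurableSpace V] {μ : Measure V} {E : Set V}
    (hEt : μ E ≠ ⊤) {φ : V → ℝ} (hφ0 : ∀ y, 0 ≤ φ y)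
    (hφ : IntegrableOn φ E μ) {b : ℝ} (hb : ⨍ y in E, φ y ∂μ < b)
    {E' : Set V} (hsub : E' ⊆ E) (hlt : ∀ y ∈ E, φ y < 2 * b → y ∈ E') :
    μ.real E / 2 ≤ μ.real E' := by
  have ha0 : 0 ≤ ⨍ y in E, φ y ∂μ := by
    rw [setAverage_eq, smul_eq_mul]
    exact mul_nonneg (by positivity) (integral_nonneg hφ0)
  have hb0 : 0 < b := ha0.trans_lt hb
  have hint : ∫ y in E, φ y ∂μ ≤ b * μ.real E := by
    rcases (measureReal_nonneg (μ := μ) (s := E)).eq_or_lt with h | h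
    · have h0 : μ E = 0 := (measureReal_eq_zero_iff hEt).1 h.symm
      rw [Measure.restrict_eq_zero.2 h0, ← h]
      simp
    · rw [setAverage_eq, smul_eq_mul, inv_mul_lt_iff₀ h] at hb
      linarith
  have hmarkov := mul_meas_ge_le_integral_of_nonneg (Filter.Eventually.of_forall hφ0) hφ (2 * b)
  have hle : μ.real (E \ E') ≤ (μ.restrict E).real {y | 2 * b ≤ φ y} := by
    have hsub' : E \ E' ⊆ {y | 2 * b ≤ φ y} ∩ E := fun y hy =>
      ⟨le_of_not_gt fun h => hy.2 (hlt y hy.1 h), hy.1⟩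
    rw [measureReal_def, measureReal_def]
    refine ENNReal.toReal_mono ?_ ?_
    · exact ne_top_of_le_ne_top hEt ((measure_mono (subset_univ _)).trans_eq (by simp))
    · exact (measure_mono hsub').trans (Measure.le_restrict_apply _ _)
  have hsplit : μ.real E ≤ μ.real E' + μ.real (E \ E') := by
    rw [← union_sdiff_cancel hsub]
    refine (measureReal_union_le _ _).trans_eq ?_
    rw [union_sdiff_cancel hsub]
  have h2 : b * (2 * μ.real (E \ E')) ≤ b * μ.real E := by
    have := mul_le_mul_of_nonneg_left hle (show 0 ≤ 2 * b by linarith)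
    linarith
  have h3 := le_of_mul_le_mul_left h2 hb0
  linarith

/-- **Observability/propagation of smallness for real-analytic functions**
(Theorem 3 of the paper, quantitative form).  The multi-index bounds
`|∂^α f(x)| ≤ M |α|! (ρR)^{-|α|}` are encoded by bounding, for every order `k`
and every choice of coordinate directions `m : Fin k → Fin n`, the iterated
derivative of `f` applied to the corresponding coordinate vectors. -/
theorem null_control_stmt_0
    (n : ℕ) (hn : 1 ≤ n) (ρ c : ℝ) (hρ0 : 0 < ρ) (hρ1 : ρ ≤ 1) (hc : 0 < c) :
    ∃ N θ : ℝ, 0 < N ∧ θ ∈ Set.Ioo (0 : ℝ) 1 ∧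
      ∀ (R M : ℝ) (f : EuclideanSpace ℝ (Fin n) → ℝ)
        (E : Set (EuclideanSpace ℝ (Fin n))),
        0 < R → 0 < M →
        ContDiffOn ℝ (⊤ : ℕ∞) f (ball (0 : EuclideanSpace ℝ (Fin n)) (2 * R)) →
        (∀ (k : ℕ) (m : Fin k → Fin n),
          ∀ x ∈ ball (0 : EuclideanSpace ℝ (Fin n)) (2 * R),
            |iteratedFDerivWithin ℝ k f
                (ball (0 : EuclideanSpace ℝ (Fin n)) (2 * R)) x
                (fun j => EuclideanSpace.single (m j) (1 : ℝ))| ≤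
              M * (Nat.factorial k) / (ρ * R) ^ k) →
        MeasurableSet E →
        E ⊆ ball (0 : EuclideanSpace ℝ (Fin n)) (R / 2) →
        volume E = ENNReal.ofReal c *
          volume (ball (0 : EuclideanSpace ℝ (Fin n)) R) →
        ∀ x ∈ ball (0 : EuclideanSpace ℝ (Fin n)) R,
          |f x| ≤ N * (⨍ y in E, |f y| ∂volume) ^ θ * M ^ (1 - θ) := by
  have hn0 : (0 : ℝ) < n := by exact_mod_cast hn
  have hn1 : (1 : ℝ) ≤ n := by exact_mod_cast hn
  set δ₀ : ℝ := min (c / 2) 1 with hδ₀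
  have hδ₀0 : 0 < δ₀ := lt_min (by positivity) one_pos
  have hδ₀1 : δ₀ ≤ 1 := min_le_right _ _
  set δ : ℝ := δ₀ ^ 2 / (8 * n) with hδ
  have hδ0 : 0 < δ := by positivity
  have hδ1 : δ ≤ 1 / 2 := by
    rw [hδ, div_le_div_iff₀ (by positivity) (by norm_num)]
    nlinarith
  set A : ℝ := 2 * n / ρ with hA
  have hA0 : 0 < A := by positivity
  obtain ⟨K, hK⟩ := exists_nat_gt (2 * A * 48 / δ)
  have hK0 : (0 : ℝ) < K := lt_trans (by positivity) hK
  have hKn : 0 < K := by exact_mod_cast hK0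
  have hAK : 2 * A * (2 / K) ≤ δ / 24 := by
    rw [div_lt_iff₀ hδ0] at hK
    rw [mul_div_assoc', div_le_div_iff₀ hK0 (by norm_num)]
    linarith
  set θ₀ : ℝ := Real.log 2 / Real.log (2 * (12 / δ)) with hθ₀
  have h12 : 2 < 2 * (12 / δ) := by
    have : 1 < 12 / δ := by rw [one_lt_div hδ0]; linarith
    linarith
  have hθ₀0 : 0 < θ₀ := div_pos (Real.log_pos (by norm_num)) (Real.log_pos (by linarith))
  have hθ₀1 : θ₀ < 1 := (div_lt_one (Real.log_pos (by linarith))).2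
    (Real.log_lt_log (by norm_num) h12)
  have hθ0 : 0 < θ₀ ^ K := by positivity
  have hθ1 : θ₀ ^ K < 1 := pow_lt_one₀ hθ₀0.le hθ₀1 hKn.ne'
  refine ⟨2 * 6 ^ K, θ₀ ^ K, by positivity, ⟨hθ0, hθ1⟩, ?_⟩
  intro R M f E hR hM hf hbd hE hER hvol x hx
  set θ : ℝ := θ₀ ^ K with hθ
  set a : ℝ := ⨍ y in E, |f y| ∂volume with ha
  have hsubR : ball (0 : EuclideanSpace ℝ (Fin n)) R ⊆ ball 0 (2 * R) :=
    ball_subset_ball (by linarith)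
  have hER' : E ⊆ ball 0 R := hER.trans (ball_subset_ball (by linarith))
  have hfM : ∀ y ∈ ball (0 : EuclideanSpace ℝ (Fin n)) (2 * R), |f y| ≤ M := by
    intro y hy
    simpa using hbd 0 Fin.elim0 y hy
  have hEt : volume E ≠ ⊤ := (measure_mono hER').trans_lt measure_ball_lt_top |>.ne
  have hint : IntegrableOn (fun y => |f y|) E volume := by
    refine Integrable.mono' (g := fun _ => M) (integrableOn_const hEt) ?_ ?_
    · exact ((hf.continuousOn.mono (hER'.trans hsubR)).abs).aestronglyMeasurable hE
    · refine (ae_restrict_iff' hE).2 (Filter.Eventually.of_forall fun y hy => ?_)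
      rw [Real.norm_eq_abs, abs_abs]
      exact hfM y (hsubR (hER' hy))
  have ha0 : 0 ≤ a := by
    rw [ha, setAverage_eq, smul_eq_mul]
    exact mul_nonneg (by positivity) (integral_nonneg fun _ => abs_nonneg _)
  have key : ∀ b > a, |f x| ≤ 2 * 6 ^ K * b ^ θ * M ^ (1 - θ) := by
    intro b hab
    have hb0 : 0 < b := ha0.trans_lt hab
    set E' : Set (EuclideanSpace ℝ (Fin n)) :=
      E ∩ (ball 0 (2 * R) ∩ (fun y => |f y|) ⁻¹' Iio (2 * b)) with hE'
    have hE'm : MeasurableSet E' :=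
      hE.inter (hf.continuousOn.abs.isOpen_inter_preimage isOpen_ball isOpen_Iio).measurableSet
    have hhalf := half_measure_le_of_average_lt (E' := E') hEt (fun y => abs_nonneg (f y)) hint hab
      inter_subset_left fun y hy hlt => ⟨hy, hsubR (hER' hy), hlt⟩
    have hE'vol : ENNReal.ofReal δ₀ * volume (ball (0 : EuclideanSpace ℝ (Fin n)) R)
        ≤ volume E' := by
      have hE't : volume E' ≠ ⊤ := ne_top_of_le_ne_top hEt (measure_mono inter_subset_left)
      have hBt : volume (ball (0 : EuclideanSpace ℝ (Fin n)) R) ≠ ⊤ := measure_ball_lt_top.ne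
      rw [← ENNReal.ofReal_toReal hE't, ← ENNReal.ofReal_toReal hBt,
        ← ENNReal.ofReal_mul hδ₀0.le]
      apply ENNReal.ofReal_le_ofReal
      refine le_trans ?_ hhalf
      rw [measureReal_def, hvol, ENNReal.toReal_mul, ENNReal.toReal_ofReal hc.le]
      have : δ₀ ≤ c / 2 := min_le_left _ _
      have h := mul_le_mul_of_nonneg_right this
        (ENNReal.toReal_nonneg (a := volume (ball (0 : EuclideanSpace ℝ (Fin n)) R)))
      linarith
    obtain ⟨y, hy, hyvol⟩ := exists_segment_inter_measure hn hR hδ₀0 hδ₀1 hE'm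
      (inter_subset_left.trans hER') hE'vol hx
    set U : Set ℝ := {r : ℝ | x + r • (y - x) ∈ ball (0 : EuclideanSpace ℝ (Fin n)) (2 * R)} with hU
    have hUo : IsOpen U := isOpen_ball.preimage (by fun_prop)
    have hU01 : Icc (0 : ℝ) 1 ⊆ U := fun r hr =>
      hsubR ((convex_ball _ _).add_smul_sub_mem hx hy hr)
    have hgU : ContDiffOn ℝ (⊤ : ℕ∞) (fun r : ℝ => f (x + r • (y - x))) U :=
      hf.comp (by fun_prop) fun r hr => hr
    have hsum : ∑ i, |(y - x) i| ≤ n * (2 * R) := by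
      have hyx : ‖y - x‖ ≤ 2 * R := by
        have h1 := norm_sub_le y x
        have h2 := mem_ball_zero_iff.1 hx
        have h3 := mem_ball_zero_iff.1 hy
        linarith
      calc ∑ i, |(y - x) i| ≤ ∑ _i : Fin n, 2 * R := by
            refine Finset.sum_le_sum fun i _ => le_trans ?_ hyx
            exact PiLp.norm_apply_le (y - x) i
        _ = _ := by simp
    have hgbound : ∀ k : ℕ, ∀ s ∈ U,
        |iteratedDerivWithin k (fun r : ℝ => f (x + r • (y - x))) U s|
          ≤ M * k.factorial * A ^ k := by
      intro k s hs
      rw [hU, iteratedDerivWithin_comp_line isOpen_ball hf x (y - x) k hs]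
      refine (abs_apply_diag_le _ (fun m => hbd k m _ hs) (y - x)).trans ?_
      calc _ ≤ (n * (2 * R)) ^ k * (M * k.factorial / (ρ * R) ^ k) := by gcongr
        _ = M * k.factorial * (n * (2 * R) / (ρ * R)) ^ k := by rw [div_pow]; ring
        _ = _ := by
            congr 2
            rw [hA]
            field_simp
    have hfin := abs_zero_le_of_polynomial_approx (B := min (2 * b / M) 1)
      (g := fun r : ℝ => f (x + r • (y - x)) / M) hKn hδ0 hδ1 (by positivity : 0 ≤ 2 * A)
      hAK (by positivity) (min_le_right _ _)
      (fun s hs => by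
        rw [abs_div, abs_of_pos hM, div_le_one hM]
        exact hfM _ (hU01 hs))
      (fun u v hu huv hv k => exists_polynomial_approx hA0.le hM hUo hgU hgbound huv
        ((Icc_subset_Icc hu hv).trans hU01) k)
      (fun s hs => hs.1) hyvol
      (fun s hs => by
        rw [abs_div, abs_of_pos hM]
        refine le_min ?_ ?_
        · gcongr
          exact (mem_Iio.1 hs.2.2.2).le
        · rw [div_le_one hM]
          exact hfM _ (hU01 hs.1))
    rw [zero_smul, add_zero, abs_div, abs_of_pos hM, div_le_iff₀ hM] at hfin
    refine hfin.trans ?_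
    rw [← hθ₀, ← hθ]
    have h2 : (2 : ℝ) ^ θ ≤ 2 := by
      conv_rhs => rw [← Real.rpow_one 2]
      exact Real.rpow_le_rpow_of_exponent_le (by norm_num) hθ1.le
    calc 6 ^ K * (min (2 * b / M) 1) ^ θ * M ≤ 6 ^ K * (2 * b / M) ^ θ * M := by
          gcongr
          exact min_le_left _ _
      _ = 2 ^ θ * 6 ^ K * b ^ θ * M ^ (1 - θ) := by
          rw [Real.div_rpow (by positivity) hM.le, Real.mul_rpow (by norm_num) hb0.le,
            Real.rpow_sub hM, Real.rpow_one]
          ring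
      _ ≤ _ := by gcongr
  have hcont : Filter.Tendsto (fun b : ℝ => 2 * 6 ^ K * b ^ θ * M ^ (1 - θ)) (nhdsWithin a (Ioi a))
      (nhds (2 * 6 ^ K * a ^ θ * M ^ (1 - θ))) := by
    refine Filter.Tendsto.mono_left ?_ nhdsWithin_le_nhds
    exact ((Real.continuousAt_rpow_const a θ (Or.inr hθ0.le)).const_mul _).mul_const _
  exact ge_of_tendsto hcont (Filter.eventually_of_mem self_mem_nhdsWithin key)
end

section
/- Let $n \ge 1$, $M > 0$ and $0 < \rho \le 1$. Suppose $f : B_{2} \subset \mathbb{R}^n \to \mathbb{R}$ is infinitely differentiable and satisfies $|\partial^\alpha f(x)| \le M\,|\alpha|!\,\rho^{-|\alpha|}$ for every $x \in B_{2}$ and every multi-index $\alpha \in \mathbb{N}^n$. Let $E \subset B_{1/2}$ be a Lebesgue measurable set with $|E| > 0$. Then there exist constants $N > 0$ and $\gamma \in (0,1)$, depending only on $n$, $\rho$ and $|E|$, such that $\|f\|_{L^\infty(B_{1/2})} \le N\, \|f\|_{L^\infty(E)}^{\gamma} M^{1-\gamma}$. -/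
open MeasureTheory Metric Set

theorem abs_volume_inter_Iic_sub_le {S : Set ℝ} (hS : IsCompact S) (s t : ℝ) :
    |volume.real (S ∩ Iic s) - volume.real (S ∩ Iic t)| ≤ |s - t| := by
  wlog h : t ≤ s generalizing s t
  · rw [abs_sub_comm, abs_sub_comm s]
    exact this t s (le_of_not_ge h)
  have hfin : ∀ u, volume (S ∩ Iic u) ≠ ⊤ := fun u =>
    ((measure_mono inter_subset_left).trans_lt hS.measure_lt_top).ne
  have h1 : volume.real (S ∩ Iic t) ≤ volume.real (S ∩ Iic s) :=
    measureReal_mono (by gcongr) (hfin s)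
  have h2 : volume.real (S ∩ Iic s) ≤ volume.real (S ∩ Iic t) + volume.real (Ioc t s) := by
    refine (measureReal_mono (fun x hx => ?_) ?_).trans (measureReal_union_le _ _)
    · by_cases hxt : x ≤ t
      · exact Or.inl ⟨hx.1, hxt⟩
      · exact Or.inr ⟨not_le.1 hxt, hx.2⟩
    · exact measure_union_ne_top (hfin t) (by simp)
  rw [Real.volume_real_Ioc_of_le h] at h2
  rw [abs_of_nonneg (by linarith), abs_of_nonneg (by linarith)]
  linarith

theorem exists_mem_volume_inter_Iic_eq {S : Set ℝ} (hS : IsCompact S) {y : ℝ} (hy : 0 < y)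
    (hyS : y ≤ volume.real S) : ∃ s ∈ S, volume.real (S ∩ Iic s) = y := by
  obtain ⟨a, ha⟩ := hS.bddBelow
  obtain ⟨b, hb⟩ := hS.bddAbove
  have hcont : Continuous fun u => volume.real (S ∩ Iic u) := by
    refine (LipschitzWith.of_dist_le_mul (K := 1) fun s t => ?_).continuous
    simpa [Real.dist_eq] using abs_volume_inter_Iic_sub_le hS s t
  have hlow : volume.real (S ∩ Iic (a - 1)) = 0 := by
    have : S ∩ Iic (a - 1) = ∅ := by
      ext x
      simp only [mem_inter_iff, mem_Iic, mem_empty_iff_false, iff_false, not_and]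
      intro hx hxa
      linarith [ha hx]
    simp [this]
  have hhigh : volume.real (S ∩ Iic b) = volume.real S := by
    rw [inter_eq_left.2 (show S ⊆ Iic b from fun x hx => hb hx)]
  have hab : a - 1 ≤ b := by
    by_contra! h
    have : S = ∅ := by
      ext x
      simp only [mem_empty_iff_false, iff_false]
      intro hx
      linarith [ha hx, hb hx]
    simp only [this, measureReal_empty] at hyS
    linarith
  obtain ⟨u, -, hu⟩ := intermediate_value_Icc hab hcont.continuousOn
    (show y ∈ Icc _ _ from ⟨by rw [hlow]; exact hy.le, by rw [hhigh]; exact hyS⟩)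
  simp only at hu
  have hne : (S ∩ Iic u).Nonempty := by
    by_contra! h
    rw [h, measureReal_empty] at hu
    linarith
  have hmem := (hS.inter_right isClosed_Iic).sSup_mem hne
  refine ⟨_, hmem.1, ?_⟩
  rw [← hu]
  congr 1
  ext x
  refine ⟨fun hx => ⟨hx.1, le_trans (mem_Iic.1 hx.2) hmem.2⟩, fun hx => ⟨hx.1, ?_⟩⟩
  exact le_csSup ⟨u, fun z hz => hz.2⟩ hx

theorem exists_spaced_points {S : Set ℝ} (hS : IsCompact S) {c : ℝ} (hc : 0 < c)
    (hcS : c ≤ volume.real S) (k : ℕ) :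
    ∃ t : ℕ → ℝ, (∀ j ∈ Finset.range (k + 1), t j ∈ S) ∧
      ∀ i ∈ Finset.range (k + 1), ∀ j ∈ Finset.range (k + 1),
        |(i : ℝ) - j| * (c / (k + 1)) ≤ |t i - t j| := by
  have h : ∀ j : ℕ, ∃ s : ℝ, j ∈ Finset.range (k + 1) →
      s ∈ S ∧ volume.real (S ∩ Iic s) = (j + 1) * (c / (k + 1)) := by
    intro j
    by_cases hj : j ∈ Finset.range (k + 1)
    · obtain ⟨s, hs, hs'⟩ := exists_mem_volume_inter_Iic_eq hS
        (y := (j + 1) * (c / (k + 1))) (by positivity) (by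
          refine le_trans ?_ hcS
          have : (j : ℝ) ≤ k := by exact_mod_cast Nat.lt_succ_iff.1 (Finset.mem_range.1 hj)
          rw [mul_div_assoc', div_le_iff₀ (by positivity)]
          nlinarith)
      exact ⟨s, fun _ => ⟨hs, hs'⟩⟩
    · exact ⟨0, fun h => (hj h).elim⟩
  choose t ht using h
  refine ⟨t, fun j hj => (ht j hj).1, fun i hi j hj => ?_⟩
  refine le_trans (le_of_eq ?_) (abs_volume_inter_Iic_sub_le hS (t i) (t j))
  rw [(ht i hi).2, (ht j hj).2, ← sub_mul, abs_mul, abs_of_pos (a := c / (k + 1)) (by positivity)]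
  congr 2
  ring

theorem prod_erase_abs_sub (j l : ℕ) :
    ∏ i ∈ (Finset.range (j + l + 1)).erase j, |(i : ℝ) - j| = j.factorial * l.factorial := by
  induction l with
  | zero =>
    have h : (Finset.range (j + 0 + 1)).erase j = Finset.range j := by
      ext x
      simp only [Finset.mem_erase, Finset.mem_range]
      omega
    rw [h, ← Finset.prod_range_reflect, ← Finset.prod_range_add_one_eq_factorial]
    push_cast
    simp only [Nat.factorial_zero, Nat.cast_one, mul_one]
    refine Finset.prod_congr rfl fun i hi => ?_
    have := Finset.mem_range.1 hi
    rw [show j - 1 - i = j - (i + 1) by omega, Nat.cast_sub (by omega), abs_sub_comm]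
    push_cast
    rw [abs_of_nonneg (by linarith [(Nat.cast_nonneg i : (0 : ℝ) ≤ i)])]
    ring
  | succ l ih =>
    have h : (Finset.range (j + (l + 1) + 1)).erase j
        = insert (j + l + 1) ((Finset.range (j + l + 1)).erase j) := by
      ext x
      simp only [Finset.mem_erase, Finset.mem_range, Finset.mem_insert]
      omega
    rw [h, Finset.prod_insert (by simp), ih, Nat.factorial_succ]
    push_cast
    rw [show (j : ℝ) + l + 1 - j = l + 1 by ring, abs_of_nonneg (by positivity)]
    ring

theorem sum_inv_factorial_mul_factorial (k : ℕ) :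
    ∑ j ∈ Finset.range (k + 1), ((j.factorial : ℝ) * (k - j).factorial)⁻¹
      = 2 ^ k / k.factorial := by
  have h : (2 : ℝ) ^ k = ∑ j ∈ Finset.range (k + 1), (k.choose j : ℝ) := by
    exact_mod_cast (Nat.sum_range_choose k).symm
  rw [h, Finset.sum_div]
  refine Finset.sum_congr rfl fun j hj => ?_
  rw [Nat.cast_choose ℝ (Nat.lt_succ_iff.1 (Finset.mem_range.1 hj))]
  have := Nat.factorial_ne_zero k
  field_simp

theorem two_mul_pow_div_factorial_le (k : ℕ) {θ : ℝ} (hθ : 0 < θ) (hθ1 : θ ≤ 1) :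
    ((k + 1 : ℝ) / θ) ^ k * (2 ^ k / k.factorial) ≤ (6 / θ) ^ (k + 1) := by
  have h1 : ((k + 1 : ℕ) : ℝ) ^ (k + 1) / (k + 1).factorial ≤ 3 ^ (k + 1) := by
    refine (Real.pow_div_factorial_le_exp _ (by positivity) _).trans ?_
    rw [← mul_one ((k + 1 : ℕ) : ℝ), Real.exp_nat_mul]
    gcongr
    linarith [Real.exp_one_lt_d9]
  have h2 : ((k + 1 : ℕ) : ℝ) ^ (k + 1) / (k + 1).factorial = (k + 1) ^ k / k.factorial := by
    rw [Nat.factorial_succ]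
    push_cast
    have := Nat.factorial_ne_zero k
    field_simp
    ring
  rw [h2] at h1
  calc ((k + 1 : ℝ) / θ) ^ k * (2 ^ k / k.factorial)
      = ((k + 1) ^ k / k.factorial) * ((2 / θ) ^ k) := by
        rw [div_pow, div_pow]; field_simp
    _ ≤ 3 ^ (k + 1) * (2 / θ) ^ (k + 1) := by
        gcongr
        · rw [le_div_iff₀ hθ]; linarith
        · omega
    _ = (6 / θ) ^ (k + 1) := by
        rw [← mul_pow]; congr 1; ring

theorem abs_eval_le_of_spaced_points {P : Polynomial ℝ} {k : ℕ} (hP : P.natDegree ≤ k)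
    {t : ℕ → ℝ} {a L θ η x : ℝ} (hL : 0 < L) (hθ : 0 < θ) (hθ1 : θ ≤ 1)
    (ht : ∀ j ∈ Finset.range (k + 1), t j ∈ Icc a (a + L))
    (hsep : ∀ i ∈ Finset.range (k + 1), ∀ j ∈ Finset.range (k + 1),
        |(i : ℝ) - j| * (θ * L / (k + 1)) ≤ |t i - t j|)
    (hη : ∀ j ∈ Finset.range (k + 1), |P.eval (t j)| ≤ η) (hx : x ∈ Icc a (a + L)) :
    |P.eval x| ≤ (6 / θ) ^ (k + 1) * η := by
  have hη0 : 0 ≤ η := (abs_nonneg _).trans (hη 0 (by simp))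
  have hinj : Set.InjOn t (Finset.range (k + 1)) := by
    intro i hi j hj hij
    have h := hsep i hi j hj
    rw [hij, sub_self, abs_zero] at h
    have h0 : |(i : ℝ) - j| ≤ 0 := by
      by_contra! h'
      have : 0 < |(i : ℝ) - j| * (θ * L / (k + 1)) := by positivity
      linarith
    have := abs_eq_zero.1 (le_antisymm h0 (abs_nonneg _))
    exact_mod_cast sub_eq_zero.1 this
  have hPI := Lagrange.eq_interpolate hinj (f := P) (by
    rw [Finset.card_range]
    exact (Polynomial.degree_le_of_natDegree_le hP).trans_lt (by exact_mod_cast Nat.lt_succ_self k))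
  have hbasis : ∀ j ∈ Finset.range (k + 1),
      |(Lagrange.basis (Finset.range (k + 1)) t j).eval x|
        ≤ ((k + 1 : ℝ) / θ) ^ k * ((j.factorial : ℝ) * (k - j).factorial)⁻¹ := by
    intro j hj
    have hjk : j ≤ k := Nat.lt_succ_iff.1 (Finset.mem_range.1 hj)
    have hprod := prod_erase_abs_sub j (k - j)
    rw [Nat.add_sub_cancel' hjk] at hprod
    rw [← hprod, Lagrange.basis, Polynomial.eval_prod, Finset.abs_prod, ← Finset.prod_inv_distrib]
    have hcard : ((Finset.range (k + 1)).erase j).card = k := by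
      rw [Finset.card_erase_of_mem hj, Finset.card_range, Nat.add_sub_cancel]
    have hconst : ((k + 1 : ℝ) / θ) ^ k
        = ∏ _i ∈ (Finset.range (k + 1)).erase j, ((k + 1 : ℝ) / θ) := by
      rw [Finset.prod_const, hcard]
    rw [hconst, ← Finset.prod_mul_distrib]
    refine Finset.prod_le_prod (fun _ _ => abs_nonneg _) fun i hi => ?_
    obtain ⟨hij, hi⟩ := Finset.mem_erase.1 hi
    have hpos : 0 < |(i : ℝ) - j| := abs_pos.2 (sub_ne_zero.2 (by exact_mod_cast hij))
    have hs := hsep i hi j hj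
    have hxi : |x - t i| ≤ L := by
      have := ht i hi
      rw [abs_le]
      constructor <;> linarith [hx.1, hx.2, this.1, this.2]
    rw [Lagrange.basisDivisor]
    simp only [Polynomial.eval_mul, Polynomial.eval_C, Polynomial.eval_sub, Polynomial.eval_X,
      abs_mul, abs_inv]
    rw [abs_sub_comm (t j)]
    calc |t i - t j|⁻¹ * |x - t i| ≤ (|(i : ℝ) - j| * (θ * L / (k + 1)))⁻¹ * L := by gcongr
      _ = (k + 1 : ℝ) / θ * |(i : ℝ) - j|⁻¹ := by field_simp
  rw [hPI, Lagrange.interpolate_apply, Polynomial.eval_finsetSum]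
  calc |∑ j ∈ Finset.range (k + 1), Polynomial.eval x (Polynomial.C (P.eval (t j))
          * Lagrange.basis (Finset.range (k + 1)) t j)|
      ≤ ∑ j ∈ Finset.range (k + 1), η *
          (((k + 1 : ℝ) / θ) ^ k * ((j.factorial : ℝ) * (k - j).factorial)⁻¹) := by
        refine (Finset.abs_sum_le_sum_abs _ _).trans (Finset.sum_le_sum fun j hj => ?_)
        rw [Polynomial.eval_mul, Polynomial.eval_C, abs_mul]
        exact mul_le_mul (hη j hj) (hbasis j hj) (abs_nonneg _) hη0
    _ = η * (((k + 1 : ℝ) / θ) ^ k * (2 ^ k / k.factorial)) := by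
        rw [← Finset.mul_sum, ← Finset.mul_sum, sum_inv_factorial_mul_factorial]
    _ ≤ η * (6 / θ) ^ (k + 1) := by gcongr; exact two_mul_pow_div_factorial_le k hθ hθ1
    _ = (6 / θ) ^ (k + 1) * η := mul_comm _ _

/-- `g` is continuous and bounded by `1` on `[0, 1]`, and on each interval `[a, 1]` it is
approximated by polynomials centred at `a` with a geometric rate governed by `A`. -/
structure TaylorApprox (A : ℝ) (g : ℝ → ℝ) : Prop where
  continuousOn : ContinuousOn g (Icc 0 1)
  abs_le_one : ∀ t ∈ Icc (0 : ℝ) 1, |g t| ≤ 1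
  approx : ∀ a ∈ Ico (0 : ℝ) 1, ∀ k : ℕ, ∃ P : Polynomial ℝ, P.natDegree ≤ k ∧
    ∀ t ∈ Icc a 1, |g t - P.eval t| ≤ (A * (t - a)) ^ (k + 1)

theorem exists_le_mul_rpow_of_forall_le {B : ℝ} (hB : 1 < B) :
    ∃ N γ : ℝ, 0 < N ∧ γ ∈ Ioo (0 : ℝ) 1 ∧ ∀ y δ : ℝ, 0 ≤ δ → δ ≤ 1 →
      (∀ k : ℕ, y ≤ B ^ (k + 1) * δ + 2 * (1 / 2) ^ (k + 1)) → y ≤ N * δ ^ γ := by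
  have hlog2 : 0 < Real.log 2 := Real.log_pos (by norm_num)
  have hlogB : 0 < Real.log B := Real.log_pos hB
  have hlog : Real.log (2 * B) = Real.log 2 + Real.log B :=
    Real.log_mul (by norm_num) (by linarith)
  have hγ : Real.log 2 / Real.log (2 * B) ∈ Ioo (0 : ℝ) 1 := by
    rw [hlog]
    exact ⟨by positivity, (div_lt_one (by positivity)).2 (by linarith)⟩
  have h2 : (2 * B) ^ (Real.log 2 / Real.log (2 * B)) = 2 := by
    rw [Real.rpow_def_of_pos (by positivity), mul_div_cancel₀ _ (by rw [hlog]; positivity),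
      Real.exp_log (by norm_num)]
  generalize Real.log 2 / Real.log (2 * B) = γ at hγ h2
  refine ⟨2 * B + 2, γ, by positivity, hγ, fun y δ hδ hδ1 h => ?_⟩
  rcases hδ.eq_or_lt with rfl | hδ
  · rw [Real.zero_rpow hγ.1.ne', mul_zero]
    have ht : Filter.Tendsto (fun k : ℕ => 2 * (1 / 2 : ℝ) ^ (k + 1)) Filter.atTop
        (nhds (2 * 0)) :=
      ((tendsto_pow_atTop_nhds_zero_of_lt_one (by norm_num) (by norm_num)).comp
        (Filter.tendsto_add_atTop_nat 1)).const_mul 2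
    rw [mul_zero] at ht
    exact ge_of_tendsto' ht fun k => by simpa using h k
  · obtain ⟨k, hk, hk'⟩ := exists_nat_pow_near (one_le_inv₀ hδ |>.2 hδ1)
      (show 1 < 2 * B by linarith)
    have hhalf : (1 / 2 : ℝ) ^ (k + 1) ≤ δ ^ γ := by
      have : (2 : ℝ) ^ (k + 1) = ((2 * B) ^ (k + 1)) ^ γ := by
        rw [← Real.rpow_natCast (2 * B), ← Real.rpow_mul (by positivity), mul_comm ((k + 1 : ℕ) : ℝ),
          Real.rpow_mul (by positivity), h2, Real.rpow_natCast]
      rw [one_div, inv_pow, this, ← Real.inv_rpow (by positivity)]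
      refine Real.rpow_le_rpow (by positivity) ?_ hγ.1.le
      exact inv_le_of_inv_le₀ hδ hk'.le
    have hBk : B ^ (k + 1) * δ ≤ 2 * B * (1 / 2) ^ (k + 1) := by
      have h1 : (2 * B) ^ (k + 1) * δ ≤ 2 * B := by
        rw [pow_succ, mul_comm ((2 * B) ^ k), mul_assoc]
        have : (2 * B) ^ k * δ ≤ 1 := by
          rwa [← le_div_iff₀ hδ, one_div]
        nlinarith
      calc B ^ (k + 1) * δ = (2 * B) ^ (k + 1) * δ * (1 / 2) ^ (k + 1) := by
            rw [mul_pow, one_div, inv_pow]; field_simp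
        _ ≤ _ := by gcongr
    calc y ≤ _ := h k
      _ ≤ 2 * B * (1 / 2) ^ (k + 1) + 2 * (1 / 2) ^ (k + 1) := by gcongr
      _ = (2 * B + 2) * (1 / 2) ^ (k + 1) := by ring
      _ ≤ _ := by gcongr

theorem TaylorApprox.exists_holder_of_short_interval {θ : ℝ} (hθ : 0 < θ) (hθ1 : θ ≤ 1) :
    ∃ N γ : ℝ, 0 < N ∧ γ ∈ Ioo (0 : ℝ) 1 ∧ ∀ (A : ℝ) (g : ℝ → ℝ) (a L δ : ℝ),
      0 ≤ A → TaylorApprox A g → 0 < L → 0 ≤ a → a + L ≤ 1 → A * L * (6 / θ) ≤ 1 / 2 →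
      0 ≤ δ → δ ≤ 1 → θ * L ≤ volume.real {t ∈ Icc a (a + L) | |g t| ≤ δ} →
      ∀ x ∈ Icc a (a + L), |g x| ≤ N * δ ^ γ := by
  have hB : 1 < 6 / θ := by rw [lt_div_iff₀ hθ]; linarith
  obtain ⟨N, γ, hN, hγ, h⟩ := exists_le_mul_rpow_of_forall_le hB
  refine ⟨N, γ, hN, hγ, fun A g a L δ hA hg hL ha haL hAL hδ hδ1 hvol x hx => ?_⟩
  refine h _ _ hδ hδ1 fun k => ?_
  have hsub : Icc a (a + L) ⊆ Icc 0 1 := Icc_subset_Icc ha haL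
  have hcomp : IsCompact {t ∈ Icc a (a + L) | |g t| ≤ δ} := by
    refine isCompact_Icc.of_isClosed_subset ?_ (sep_subset _ _)
    exact (hg.continuousOn.mono hsub).abs.preimage_isClosed_of_isClosed isClosed_Icc isClosed_Iic
  obtain ⟨t, ht, hsep⟩ := exists_spaced_points hcomp (by positivity) hvol k
  obtain ⟨P, hP, hPg⟩ := hg.approx a ⟨ha, by linarith⟩ k
  have herr : ∀ s ∈ Icc a (a + L), |g s - P.eval s| ≤ (A * L) ^ (k + 1) := by
    intro s hs
    refine (hPg s ⟨hs.1, hs.2.trans haL⟩).trans ?_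
    have h0 : 0 ≤ s - a := by linarith [hs.1]
    gcongr
    linarith [hs.2]
  have hPx := abs_eval_le_of_spaced_points hP hL hθ hθ1 (fun j hj => (ht j hj).1) hsep
    (η := δ + (A * L) ^ (k + 1)) (fun j hj => by
      have h1 := herr _ (ht j hj).1
      have h2 : |g (t j)| ≤ δ := (ht j hj).2
      have h3 := abs_sub_abs_le_abs_sub (P.eval (t j)) (g (t j))
      rw [abs_sub_comm] at h3
      linarith) hx
  have h1 := herr x hx
  have h3 := abs_sub_abs_le_abs_sub (g x) (P.eval x)
  have hB1 : 1 ≤ (6 / θ) ^ (k + 1) := one_le_pow₀ hB.le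
  have h4 : (6 / θ) ^ (k + 1) * (A * L) ^ (k + 1) ≤ (1 / 2) ^ (k + 1) := by
    rw [← mul_pow]
    gcongr
    linarith
  have h5 : (A * L) ^ (k + 1) ≤ (6 / θ) ^ (k + 1) * (A * L) ^ (k + 1) :=
    le_mul_of_one_le_left (by positivity) hB1
  nlinarith

theorem TaylorApprox.exists_holder_chain {A : ℝ} (hA : 0 ≤ A) {J : ℕ} (hJ : 0 < J)
    (hAJ : 48 * A ≤ J) (j : ℕ) :
    ∃ N γ : ℝ, 0 < N ∧ γ ∈ Ioo (0 : ℝ) 1 ∧ ∀ i ≤ j, i + 1 ≤ J → ∀ (g : ℝ → ℝ) (δ : ℝ),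
      TaylorApprox A g → 0 ≤ δ → δ ≤ 1 →
      (∀ t ∈ Icc ((i : ℝ) / J) ((i + 1) / J), |g t| ≤ δ) → |g 0| ≤ N * δ ^ γ := by
  have hJ' : (0 : ℝ) < J := by exact_mod_cast hJ
  induction j with
  | zero =>
    refine ⟨1, 1 / 2, one_pos, by norm_num, fun i hi _ g δ hg hδ hδ1 h => ?_⟩
    obtain rfl := Nat.le_zero.1 hi
    refine (h 0 ⟨by simp, by positivity⟩).trans ?_
    rw [one_mul]
    exact Real.self_le_rpow_of_le_one hδ hδ1 (by norm_num)
  | succ j ih =>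
    obtain ⟨N, γ, hN, hγ, ih⟩ := ih
    obtain ⟨N₁, γ₁, hN₁, hγ₁, hloc⟩ :=
      TaylorApprox.exists_holder_of_short_interval (θ := 1 / 2) (by norm_num) (by norm_num)
    refine ⟨max N (N * N₁ ^ γ), γ₁ * γ, lt_max_of_lt_left hN,
      ⟨mul_pos hγ₁.1 hγ.1, mul_lt_one_of_nonneg_of_lt_one_left hγ₁.1.le hγ₁.2 hγ.2.le⟩,
      fun i hi hiJ g δ hg hδ hδ1 h => ?_⟩
    rcases Nat.le_succ_iff.1 hi with hi | rfl
    · refine (ih i hi hiJ g δ hg hδ hδ1 h).trans ?_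
      have : γ₁ * γ ≤ γ := mul_le_of_le_one_left hγ.1.le hγ₁.2.le
      have := Real.rpow_le_rpow_of_exponent_ge' hδ hδ1 (mul_pos hγ₁.1 hγ.1).le this
      gcongr
      exact le_max_left _ _
    · have hjJ : ((j : ℝ) + 1 + 1) ≤ J := by exact_mod_cast hiJ
      have hstep : ∀ x ∈ Icc ((j : ℝ) / J) (j / J + 2 / J), |g x| ≤ N₁ * δ ^ γ₁ := by
        refine hloc A g (j / J) (2 / J) δ hA hg (by positivity) (by positivity) ?_ ?_ hδ hδ1 ?_
        · rw [← add_div, div_le_one hJ']; linarith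
        · rw [show A * (2 / J) * (6 / (1 / 2)) = 24 * A / J by ring, div_le_iff₀ hJ']
          linarith
        · have hsub : Icc (((j + 1 : ℕ) : ℝ) / J) (((j + 1 : ℕ) + 1) / J)
              ⊆ {t ∈ Icc ((j : ℝ) / J) (j / J + 2 / J) | |g t| ≤ δ} := by
            refine fun t ht => ⟨⟨?_, ?_⟩, h t ht⟩
            · refine le_trans ?_ ht.1
              gcongr
              simp
            · refine ht.2.trans (le_of_eq ?_)
              push_cast
              ring
          refine le_trans (le_of_eq ?_) (measureReal_mono hsub ?_)
          · rw [Real.volume_real_Icc_of_le (by gcongr; simp)]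
            push_cast
            ring
          · exact ((measure_mono (sep_subset _ _)).trans_lt measure_Icc_lt_top).ne
      have hpos : 0 ≤ N₁ * δ ^ γ₁ := by positivity
      have hprev := ih j le_rfl (by omega) g (min 1 (N₁ * δ ^ γ₁)) hg (le_min zero_le_one hpos)
        (min_le_left _ _) fun t ht => by
          have hj0 : 0 ≤ (j : ℝ) / J := by positivity
          have hj1 : ((j : ℝ) + 1) / J ≤ 1 := by rw [div_le_one hJ']; linarith
          refine le_min (hg.abs_le_one t ⟨hj0.trans ht.1, ht.2.trans hj1⟩)
            (hstep t ⟨ht.1, ht.2.trans ?_⟩)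
          rw [← add_div]
          gcongr
          norm_num
      calc |g 0| ≤ _ := hprev
        _ ≤ N * (N₁ * δ ^ γ₁) ^ γ := by
          have := Real.rpow_le_rpow (le_min zero_le_one hpos)
            (min_le_right 1 (N₁ * δ ^ γ₁)) hγ.1.le
          gcongr
        _ = N * N₁ ^ γ * δ ^ (γ₁ * γ) := by
          rw [Real.mul_rpow hN₁.le (by positivity), ← Real.rpow_mul hδ, mul_assoc]
        _ ≤ _ := by
          gcongr
          exact le_max_right _ _

theorem exists_le_volume_inter_Icc_div {S : Set ℝ} (hS : S ⊆ Icc 0 1) {c : ℝ}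
    (hc : c ≤ volume.real S) {J : ℕ} (hJ : 0 < J) :
    ∃ i : ℕ, i + 1 ≤ J ∧ c / J ≤ volume.real (S ∩ Icc ((i : ℝ) / J) ((i + 1) / J)) := by
  have hJ' : (0 : ℝ) < J := by exact_mod_cast hJ
  by_contra! h
  have hcover : S ⊆ ⋃ i ∈ Finset.range J, S ∩ Icc ((i : ℝ) / J) ((i + 1) / J) := by
    intro t ht
    obtain ⟨h0, h1⟩ := hS ht
    simp only [mem_iUnion, Finset.mem_range]
    rcases h1.eq_or_lt with rfl | h1
    · refine ⟨J - 1, by omega, ht, ?_⟩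
      rw [Nat.cast_sub (by omega), mem_Icc, div_le_one hJ', one_le_div hJ']
      simp
    · refine ⟨⌊t * J⌋₊, ?_, ht, ?_, ?_⟩
      · rw [Nat.floor_lt (by positivity)]
        nlinarith
      · rw [div_le_iff₀ hJ']
        exact Nat.floor_le (by positivity)
      · rw [le_div_iff₀ hJ']
        exact (Nat.lt_floor_add_one _).le
  have hlt : volume.real S < ∑ i ∈ Finset.range J, c / J := by
    refine (measureReal_mono hcover ?_).trans_lt
      ((measureReal_biUnion_finset_le _ _).trans_lt (Finset.sum_lt_sum_of_nonempty
        (by simpa using hJ.ne') fun i hi => h i (Finset.mem_range.1 hi)))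
    refine ((measure_mono ?_).trans_lt (measure_Icc_lt_top (a := (0 : ℝ)) (b := 1))).ne
    exact iUnion₂_subset fun i _ => inter_subset_left.trans hS
  rw [Finset.sum_const, Finset.card_range, nsmul_eq_mul, mul_div_cancel₀ _ hJ'.ne'] at hlt
  linarith

theorem TaylorApprox.exists_holder {A c : ℝ} (hA : 0 ≤ A) (hc : 0 < c) (hc1 : c ≤ 1) :
    ∃ N γ : ℝ, 0 < N ∧ γ ∈ Ioo (0 : ℝ) 1 ∧ ∀ (g : ℝ → ℝ) (δ : ℝ),
      TaylorApprox A g → 0 ≤ δ → δ ≤ 1 →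
      c ≤ volume.real {t ∈ Icc (0 : ℝ) 1 | |g t| ≤ δ} → |g 0| ≤ N * δ ^ γ := by
  obtain ⟨J, hJge⟩ := exists_nat_ge (48 * A / c + 1)
  have hAc : 0 ≤ A / c := by positivity
  have hJ' : (0 : ℝ) < J := by
    have : 48 * A / c = 48 * (A / c) := mul_div_assoc _ _ _
    linarith
  have hJ : 0 < J := by exact_mod_cast hJ'
  have hJc : 48 * A ≤ J * c := by
    rw [← div_le_iff₀ hc]; linarith
  have hJA : 48 * A ≤ J := by nlinarith
  obtain ⟨N₁, γ₁, hN₁, hγ₁, hloc⟩ := TaylorApprox.exists_holder_of_short_interval hc hc1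
  obtain ⟨N, γ, hN, hγ, hchain⟩ := TaylorApprox.exists_holder_chain hA hJ hJA J
  refine ⟨N * N₁ ^ γ, γ₁ * γ, by positivity,
    ⟨mul_pos hγ₁.1 hγ.1, mul_lt_one_of_nonneg_of_lt_one_left hγ₁.1.le hγ₁.2 hγ.2.le⟩,
    fun g δ hg hδ hδ1 hvol => ?_⟩
  obtain ⟨i, hiJ, hi⟩ := exists_le_volume_inter_Icc_div (sep_subset _ _) hvol hJ
  have hiJ' : (i : ℝ) + 1 ≤ J := by exact_mod_cast hiJ
  have hi0 : 0 ≤ (i : ℝ) / J := by positivity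
  have hi1 : ((i : ℝ) + 1) / J ≤ 1 := by rwa [div_le_one hJ']
  have hstep : ∀ x ∈ Icc ((i : ℝ) / J) (i / J + 1 / J), |g x| ≤ N₁ * δ ^ γ₁ := by
    refine hloc A g (i / J) (1 / J) δ hA hg (by positivity) hi0 (by rwa [← add_div]) ?_ hδ hδ1 ?_
    · rw [mul_one_div, div_mul_div_comm, div_le_iff₀ (by positivity)]
      linarith
    · rw [mul_one_div]
      refine hi.trans (measureReal_mono ?_ ?_)
      · rw [← add_div]
        exact fun t ht => ⟨ht.2, ht.1.2⟩
      · exact ((measure_mono (sep_subset _ _)).trans_lt measure_Icc_lt_top).ne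
  have hpos : 0 ≤ N₁ * δ ^ γ₁ := by positivity
  have h0 := hchain i (by omega) hiJ g (min 1 (N₁ * δ ^ γ₁)) hg (le_min zero_le_one hpos)
    (min_le_left _ _) fun t ht => le_min (hg.abs_le_one t ⟨hi0.trans ht.1, ht.2.trans hi1⟩)
      (hstep t (by rwa [← add_div]))
  calc |g 0| ≤ _ := h0
    _ ≤ N * (N₁ * δ ^ γ₁) ^ γ := by
      have := Real.rpow_le_rpow (le_min zero_le_one hpos)
        (min_le_right 1 (N₁ * δ ^ γ₁)) hγ.1.le
      gcongr
    _ = N * N₁ ^ γ * δ ^ (γ₁ * γ) := by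
      rw [Real.mul_rpow hN₁.le (by positivity), ← Real.rpow_mul hδ, mul_assoc]

theorem exists_taylorWithinEval_eq_eval (g : ℝ → ℝ) (k : ℕ) (s : Set ℝ) (a : ℝ) :
    ∃ P : Polynomial ℝ, P.natDegree ≤ k ∧ ∀ t, P.eval t = taylorWithinEval g k s a t := by
  refine ⟨∑ i ∈ Finset.range (k + 1), Polynomial.C ((i.factorial : ℝ)⁻¹ *
    iteratedDerivWithin i g s a) * (Polynomial.X - Polynomial.C a) ^ i, ?_, fun t => ?_⟩
  · refine Polynomial.natDegree_sum_le_of_forall_le _ _ fun i hi => ?_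
    refine (Polynomial.natDegree_C_mul_le _ _).trans (Polynomial.natDegree_pow_le.trans ?_)
    rw [Polynomial.natDegree_X_sub_C, mul_one]
    exact Nat.lt_succ_iff.1 (Finset.mem_range.1 hi)
  · rw [taylor_within_apply, Polynomial.eval_finsetSum]
    refine Finset.sum_congr rfl fun i _ => ?_
    simp only [Polynomial.eval_mul, Polynomial.eval_C, Polynomial.eval_pow, Polynomial.eval_sub,
      Polynomial.eval_X, smul_eq_mul]
    ring

theorem TaylorApprox.of_iteratedDerivWithin_le {g : ℝ → ℝ} {M D : ℝ} (hM : 0 < M) (hD : 0 ≤ D)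
    (hg : ContDiffOn ℝ (⊤ : ℕ∞) g (Icc 0 1))
    (hbound : ∀ a ∈ Ico (0 : ℝ) 1, ∀ k : ℕ, ∀ t ∈ Icc a 1,
      |iteratedDerivWithin k g (Icc a 1) t| ≤ M * k.factorial * D ^ k) :
    TaylorApprox (2 * D) fun t => g t / M where
  continuousOn := hg.continuousOn.div_const M
  abs_le_one t ht := by
    have := hbound 0 (by simp) 0 t ht
    rw [iteratedDerivWithin_zero] at this
    rw [abs_div, abs_of_pos hM, div_le_one hM]
    simpa using this
  approx a ha k := by
    obtain ⟨P, hP, hPg⟩ := exists_taylorWithinEval_eq_eval g k (Icc a 1) a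
    refine ⟨Polynomial.C M⁻¹ * P, (Polynomial.natDegree_C_mul_le _ _).trans hP, fun t ht => ?_⟩
    have hsub : Icc a 1 ⊆ Icc 0 1 := Icc_subset_Icc_left ha.1
    have h := taylor_mean_remainder_bound ha.2.le (n := k)
      ((hg.mono hsub).of_le (by exact_mod_cast le_top)) ht
      (C := M * (k + 1).factorial * D ^ (k + 1)) fun y hy => hbound a ha (k + 1) y hy
    rw [Real.norm_eq_abs, ← hPg] at h
    have h0 : 0 ≤ t - a := sub_nonneg.2 ht.1
    have hk : (k + 1 : ℝ) ≤ 2 ^ (k + 1) := by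
      exact_mod_cast (Nat.lt_two_pow_self (n := k + 1)).le
    rw [Polynomial.eval_mul, Polynomial.eval_C,
      show g t / M - M⁻¹ * P.eval t = (g t - P.eval t) / M by ring, abs_div, abs_of_pos hM,
      div_le_iff₀ hM]
    calc |g t - P.eval t| ≤ _ := h
      _ = M * ((k + 1) * (D * (t - a)) ^ (k + 1)) := by
        rw [Nat.factorial_succ, mul_pow]
        push_cast
        have := Nat.factorial_ne_zero k
        field_simp
      _ ≤ M * (2 ^ (k + 1) * (D * (t - a)) ^ (k + 1)) := by gcongr
      _ = _ := by rw [← mul_pow]; ring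

theorem iteratedDerivWithin_comp_add_smul {E : Type*} [NormedAddCommGroup E] [NormedSpace ℝ E]
    {f : E → ℝ} {U : Set E} (hU : IsOpen U) (hf : ContDiffOn ℝ (⊤ : ℕ∞) f U) {x ω : E}
    {I : Set ℝ} (hI : UniqueDiffOn ℝ I) (hIU : ∀ t ∈ I, x + t • ω ∈ U) (k : ℕ) :
    ∀ t ∈ I, iteratedDerivWithin k (fun s : ℝ => f (x + s • ω)) I t
      = iteratedFDerivWithin ℝ k f U (x + t • ω) fun _ => ω := by
  induction k with
  | zero => intro t _; simp [iteratedDerivWithin_zero]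
  | succ k ih =>
    intro t ht
    rw [iteratedDerivWithin_succ, derivWithin_congr ih (ih t ht),
      iteratedFDerivWithin_succ_apply_left]
    have hd : HasFDerivAt (iteratedFDerivWithin ℝ k f U)
        (fderivWithin ℝ (iteratedFDerivWithin ℝ k f U) U (x + t • ω)) (x + t • ω) := by
      have := hf.differentiableOn_iteratedFDerivWithin (m := k)
        (by exact_mod_cast WithTop.coe_lt_top k) hU.uniqueDiffOn (x + t • ω) (hIU t ht)
      exact this.hasFDerivWithinAt.hasFDerivAt (hU.mem_nhds (hIU t ht))
    have hline : HasDerivAt (fun s : ℝ => x + s • ω) ω t := by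
      simpa using ((hasDerivAt_id t).smul_const ω).const_add x
    have happ := ((ContinuousMultilinearMap.apply ℝ (fun _ : Fin k => E) ℝ
      fun _ => ω).hasFDerivAt.comp_hasDerivAt t (hd.comp_hasDerivAt t hline))
    exact happ.hasDerivWithinAt.derivWithin (hI t ht)

theorem abs_multilinear_diag_le {n k : ℕ}
    (T : ContinuousMultilinearMap ℝ (fun _ : Fin k => EuclideanSpace ℝ (Fin n)) ℝ) {C : ℝ}
    (hT : ∀ m : Fin k → Fin n, |T fun j => EuclideanSpace.single (m j) (1 : ℝ)| ≤ C)
    {ω : EuclideanSpace ℝ (Fin n)} (hω : ‖ω‖ ≤ 1) : |T fun _ => ω| ≤ C * n ^ k := by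
  have hsum : ω = ∑ i, ω i • EuclideanSpace.single i (1 : ℝ) := by
    ext j
    simp [Finset.sum_apply, Pi.single_apply]
  have hexp : (T fun _ => ω) = ∑ m : Fin k → Fin n,
      (∏ j, ω (m j)) * T fun j => EuclideanSpace.single (m j) (1 : ℝ) := by
    conv_lhs => rw [hsum]
    rw [ContinuousMultilinearMap.map_sum]
    refine Finset.sum_congr rfl fun m _ => ?_
    rw [ContinuousMultilinearMap.map_smul_univ, smul_eq_mul]
  rw [hexp]
  calc |∑ m : Fin k → Fin n, (∏ j, ω (m j)) * T fun j => EuclideanSpace.single (m j) (1 : ℝ)|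
      ≤ ∑ _m : Fin k → Fin n, 1 * C := by
        refine (Finset.abs_sum_le_sum_abs _ _).trans (Finset.sum_le_sum fun m _ => ?_)
        rw [abs_mul, Finset.abs_prod]
        refine mul_le_mul (Finset.prod_le_one (fun _ _ => abs_nonneg _) fun j _ => ?_) (hT m)
          (abs_nonneg _) zero_le_one
        exact (PiLp.norm_apply_le ω (m j)).trans hω
    _ = C * n ^ k := by simp [mul_comm]

theorem exists_mem_sphere_le_volume_ray {V : Type*} [NormedAddCommGroup V] [NormedSpace ℝ V]
    [FiniteDimensional ℝ V] [Nontrivial V] [MeasurableSpace V] [BorelSpace V] (μ : Measure V)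
    [μ.IsAddHaarMeasure] {S : Set V} (hS : MeasurableSet S) (hSb : S ⊆ ball 0 1) {ε : ENNReal}
    (hε : ε * μ.toSphere univ < μ S) :
    ∃ ω ∈ sphere (0 : V) 1, ε ≤ volume {r ∈ Ioo (0 : ℝ) 1 | r • ω ∈ S} := by
  by_contra! h
  set d := Module.finrank ℝ V - 1
  set T : Set (sphere (0 : V) 1 × Ioi (0 : ℝ)) := {p | p.2.1 • p.1.1 ∈ S} with hT
  have hTm : MeasurableSet T := by
    refine measurableSet_preimage (f := fun p : sphere (0 : V) 1 × Ioi (0 : ℝ) =>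
      p.2.1 • p.1.1) ?_ hS
    exact Continuous.measurable (by fun_prop)
  have hpre : homeomorphUnitSphereProd V ⁻¹' T = Subtype.val ⁻¹' S := by
    ext v
    have := congrArg Subtype.val ((homeomorphUnitSphereProd V).symm_apply_apply v)
    rw [homeomorphUnitSphereProd_symm_apply_coe] at this
    simp only [mem_preimage, hT, mem_ofPred_eq, this]
  have hμS : μ S = (μ.toSphere.prod (Measure.volumeIoiPow d)) T := by
    rw [← (Measure.measurePreserving_homeomorphUnitSphereProd μ).measure_preimage
      hTm.nullMeasurableSet, hpre,
      comap_subtype_coe_apply (measurableSet_singleton (0 : V)).compl,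
      Subtype.image_preimage_coe, inter_comm, ← sdiff_eq, measure_sdiff_null (measure_singleton _)]
  have hslice : ∀ ω : sphere (0 : V) 1, Measure.volumeIoiPow d (Prod.mk ω ⁻¹' T) ≤ ε := by
    intro ω
    have hm : MeasurableSet (Prod.mk ω ⁻¹' T) := measurable_prodMk_left hTm
    have hr1 : ∀ r ∈ Prod.mk ω ⁻¹' T, r.1 < 1 := by
      intro r hr
      have := hSb (show r.1 • ω.1 ∈ S from hr)
      rwa [mem_ball_zero_iff, norm_smul, norm_eq_of_mem_sphere, mul_one, Real.norm_eq_abs,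
        abs_of_pos r.2] at this
    rw [Measure.volumeIoiPow, withDensity_apply _ hm]
    calc ∫⁻ r in Prod.mk ω ⁻¹' T, ENNReal.ofReal (r.1 ^ d) ∂(.comap Subtype.val volume)
        ≤ ∫⁻ r in Prod.mk ω ⁻¹' T, 1 ∂(.comap Subtype.val volume) := by
          refine setLIntegral_mono measurable_const fun r hr => ?_
          rw [ENNReal.ofReal_le_one]
          exact pow_le_one₀ r.2.le (hr1 r hr).le
      _ = volume (Subtype.val '' (Prod.mk ω ⁻¹' T)) := by
          rw [setLIntegral_one, comap_subtype_coe_apply measurableSet_Ioi]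
      _ ≤ volume {r ∈ Ioo (0 : ℝ) 1 | r • ω.1 ∈ S} := by
          refine measure_mono ?_
          rintro _ ⟨r, hr, rfl⟩
          exact ⟨⟨r.2, hr1 r hr⟩, hr⟩
      _ ≤ ε := (h ω.1 ω.2).le
  refine hε.not_ge ?_
  rw [hμS, Measure.prod_apply hTm]
  exact (lintegral_mono hslice).trans_eq (lintegral_const _)

/-- Propagation of smallness on `B_{1/2}` for functions with quantitative
analyticity bounds on `B_2` (inequality (E: casicasi) in the paper).  The
multi-index bounds `|∂^α f(x)| ≤ M |α|! ρ^{-|α|}` are encoded by bounding, for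
every order `k` and every choice of coordinate directions, the iterated
derivative of `f` applied to the corresponding coordinate vectors. -/
theorem null_control_stmt_1
    (n : ℕ) (hn : 1 ≤ n) (ρ c : ℝ) (hρ0 : 0 < ρ) (hρ1 : ρ ≤ 1) (hc : 0 < c) :
    ∃ N γ : ℝ, 0 < N ∧ γ ∈ Set.Ioo (0 : ℝ) 1 ∧
      ∀ (M : ℝ) (f : EuclideanSpace ℝ (Fin n) → ℝ)
        (E : Set (EuclideanSpace ℝ (Fin n))),
        0 < M →
        ContDiffOn ℝ (⊤ : ℕ∞) f (ball (0 : EuclideanSpace ℝ (Fin n)) 2) →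
        (∀ (k : ℕ) (m : Fin k → Fin n),
          ∀ x ∈ ball (0 : EuclideanSpace ℝ (Fin n)) 2,
            |iteratedFDerivWithin ℝ k f
                (ball (0 : EuclideanSpace ℝ (Fin n)) 2) x
                (fun j => EuclideanSpace.single (m j) (1 : ℝ))| ≤
              M * (Nat.factorial k) / ρ ^ k) →
        MeasurableSet E →
        E ⊆ ball (0 : EuclideanSpace ℝ (Fin n)) (1 / 2) →
        volume E = ENNReal.ofReal c →
        ∀ x ∈ ball (0 : EuclideanSpace ℝ (Fin n)) (1 / 2),
          |f x| ≤ N * (⨆ y ∈ E, |f y|) ^ γ * M ^ (1 - γ) := by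
  have : Nonempty (Fin n) := ⟨⟨0, hn⟩⟩
  set σ := (volume : Measure (EuclideanSpace ℝ (Fin n))).toSphere.real univ
  have hσ : 0 ≤ σ := measureReal_nonneg
  obtain ⟨N, γ, hN, hγ, hmain⟩ := TaylorApprox.exists_holder (A := 2 * (n / ρ))
    (c := min 1 (c / (σ + 1))) (by positivity) (by positivity) (min_le_left _ _)
  refine ⟨N, γ, hN, hγ, fun M f E hM hf hder hE hEb hvol x hx => ?_⟩
  have hbE : ∀ y ∈ ball (0 : EuclideanSpace ℝ (Fin n)) 2, |f y| ≤ M := fun y hy => by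
    simpa using hder 0 Fin.elim0 y hy
  have hE2 : ∀ y ∈ E, |f y| ≤ M := fun y hy => hbE y (ball_subset_ball (by norm_num) (hEb hy))
  have hinner : ∀ y, (⨆ _ : y ∈ E, |f y|) ≤ M := fun y =>
    Real.iSup_le (fun hy => hE2 y hy) hM.le
  set δ := ⨆ y ∈ E, |f y|
  have hδ0 : 0 ≤ δ := Real.iSup_nonneg fun y => Real.iSup_nonneg fun _ => abs_nonneg _
  have hδM : δ ≤ M := Real.iSup_le hinner hM.le
  have hfδ : ∀ y ∈ E, |f y| ≤ δ := fun y hy => by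
    refine le_trans ?_ (le_ciSup (f := fun y => ⨆ _ : y ∈ E, |f y|)
      ⟨M, forall_mem_range.2 hinner⟩ y)
    simp [hy]
  have hray : ENNReal.ofReal (c / (σ + 1)) * (volume : Measure (EuclideanSpace ℝ (Fin n))).toSphere univ
      < volume ((x + ·) ⁻¹' E) := by
    rw [measure_preimage_add, hvol, ← ofReal_measureReal, ← ENNReal.ofReal_mul (by positivity),
      ENNReal.ofReal_lt_ofReal_iff hc, div_mul_eq_mul_div, div_lt_iff₀ (by positivity)]
    exact mul_lt_mul_of_pos_left (lt_add_one σ) hc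
  obtain ⟨ω, hω, hωvol⟩ := exists_mem_sphere_le_volume_ray volume
    (hE.preimage (measurable_const_add x)) (fun y hy => by
      have h1 := mem_ball_zero_iff.1 (hEb hy)
      have h2 := mem_ball_zero_iff.1 hx
      rw [mem_ball_zero_iff, show y = x + y - x by abel]
      linarith [norm_sub_le (x + y) x]) hray
  have hω1 : ‖ω‖ = 1 := mem_sphere_zero_iff_norm.1 hω
  have hseg : ∀ t ∈ Icc (0 : ℝ) 1, x + t • ω ∈ ball (0 : EuclideanSpace ℝ (Fin n)) 2 := by
    intro t ht
    rw [mem_ball_zero_iff]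
    have h2 := mem_ball_zero_iff.1 hx
    have h3 : ‖t • ω‖ ≤ 1 := by
      rw [norm_smul, hω1, mul_one, Real.norm_eq_abs, abs_of_nonneg ht.1]
      exact ht.2
    linarith [norm_add_le x (t • ω)]
  have hTA : TaylorApprox (2 * (n / ρ)) fun t => f (x + t • ω) / M := by
    refine TaylorApprox.of_iteratedDerivWithin_le hM (by positivity) ?_ ?_
    · exact hf.comp (contDiff_const.add (contDiff_id.smul contDiff_const)).contDiffOn hseg
    · intro a ha k t ht
      have hsub : Icc a 1 ⊆ Icc 0 1 := Icc_subset_Icc_left ha.1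
      rw [iteratedDerivWithin_comp_add_smul isOpen_ball hf (uniqueDiffOn_Icc ha.2)
        (fun t ht => hseg t (hsub ht)) k t ht]
      refine (abs_multilinear_diag_le _ (fun m => hder k m _ (hseg t (hsub ht)))
        hω1.le).trans (le_of_eq ?_)
      rw [div_pow]
      ring
  have hfin := hmain _ (δ / M) hTA (by positivity) ((div_le_one hM).2 hδM) (by
    refine (min_le_right _ _).trans ?_
    have hne : volume {t ∈ Icc (0 : ℝ) 1 | |f (x + t • ω) / M| ≤ δ / M} ≠ ⊤ :=
      ((measure_mono (sep_subset _ _)).trans_lt measure_Icc_lt_top).ne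
    rw [measureReal_def, ← ENNReal.ofReal_le_iff_le_toReal hne]
    refine hωvol.trans (measure_mono fun t ht => ⟨Ioo_subset_Icc_self ht.1, ?_⟩)
    rw [abs_div, abs_of_pos hM]
    exact div_le_div_of_nonneg_right (hfδ _ ht.2) hM.le)
  simp only [zero_smul, add_zero] at hfin
  rw [abs_div, abs_of_pos hM, div_le_iff₀ hM, Real.div_rpow hδ0 hM.le] at hfin
  refine hfin.trans (le_of_eq ?_)
  rw [Real.rpow_sub hM, Real.rpow_one]
  ring
end

section
/- Let $E \subset [-1/5, 1/5]$ be a Lebesgue measurable set with $|E| > 0$ and let $n \ge 1$ be an integer. Then there exist $n+1$ points $x_0 < x_1 < \dots < x_n$, all belonging to the closure $\overline{E}$ of $E$, such that $x_i - x_{i-1} \ge \dfrac{|E|}{n+1}$ for every $i = 1, \dots, n$. -/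
open MeasureTheory Set

/-- The greedy sequence of points of `closure E` with gaps at least `d`, starting from `sInf E`. -/
noncomputable def greedySeparated (E : Set ℝ) (d : ℝ) : ℕ → ℝ
  | 0 => sInf E
  | k + 1 => sInf (E ∩ Ici (greedySeparated E d k + d))

theorem bddBelow_inter_Ici (E : Set ℝ) (a : ℝ) : BddBelow (E ∩ Ici a) :=
  bddBelow_Ici.mono inter_subset_right

theorem inter_Iio_sInf_inter_Ici_subset (E : Set ℝ) (a : ℝ) :
    E ∩ Iio (sInf (E ∩ Ici a)) ⊆ E ∩ Iio a := by
  rintro y ⟨hyE, hy⟩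
  refine ⟨hyE, mem_Iio.mpr (lt_of_not_ge fun hay => ?_)⟩
  exact (csInf_le (bddBelow_inter_Ici E a) ⟨hyE, hay⟩).not_gt hy

theorem measureReal_inter_Iio_add_le {E : Set ℝ} (hfin : volume E ≠ ⊤) (a : ℝ) {d : ℝ}
    (hd : 0 ≤ d) :
    volume.real (E ∩ Iio (a + d)) ≤ volume.real (E ∩ Iio a) + d := by
  have hsub : E ∩ Iio (a + d) ⊆ (E ∩ Iio a) ∪ Ico a (a + d) := by
    rintro y ⟨hyE, hy⟩
    rcases lt_or_ge y a with h | h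
    · exact Or.inl ⟨hyE, h⟩
    · exact Or.inr ⟨h, hy⟩
  have hfin' : volume (E ∩ Iio a) ≠ ⊤ := measure_ne_top_of_subset inter_subset_left hfin
  calc volume.real (E ∩ Iio (a + d))
      ≤ volume.real ((E ∩ Iio a) ∪ Ico a (a + d)) :=
        measureReal_mono hsub (measure_union_ne_top hfin' measure_Ico_lt_top.ne)
    _ ≤ volume.real (E ∩ Iio a) + volume.real (Ico a (a + d)) := measureReal_union_le _ _
    _ = volume.real (E ∩ Iio a) + d := by simp [hd]

theorem measureReal_inter_Iio_greedySeparated_le {E : Set ℝ} (hbdd : BddBelow E)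
    (hfin : volume E ≠ ⊤) {d : ℝ} (hd : 0 ≤ d) (k : ℕ) :
    volume.real (E ∩ Iio (greedySeparated E d k)) ≤ k * d := by
  induction k with
  | zero =>
    have h : E ∩ Iio (greedySeparated E d 0) = ∅ :=
      eq_empty_of_forall_notMem fun y hy => (csInf_le hbdd hy.1).not_gt hy.2
    simp [h]
  | succ k ih =>
    have hmono : volume.real (E ∩ Iio (greedySeparated E d (k + 1))) ≤
        volume.real (E ∩ Iio (greedySeparated E d k + d)) :=
      measureReal_mono (inter_Iio_sInf_inter_Ici_subset E _)
        (measure_ne_top_of_subset inter_subset_left hfin)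
    have hadd := measureReal_inter_Iio_add_le hfin (greedySeparated E d k) hd
    push_cast
    linarith

theorem nonempty_inter_Ici_greedySeparated_add {E : Set ℝ} (hbdd : BddBelow E)
    (hfin : volume E ≠ ⊤) {d : ℝ} (hd : 0 ≤ d) {k : ℕ}
    (hk : (k + 1) * d < volume.real E) :
    (E ∩ Ici (greedySeparated E d k + d)).Nonempty := by
  by_contra hempty
  have heq : E ∩ Iio (greedySeparated E d k + d) = E := by
    exact inter_eq_left.mpr fun y hy =>
      mem_Iio.mpr (lt_of_not_ge fun h => hempty ⟨y, hy, h⟩)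
  have hadd := measureReal_inter_Iio_add_le hfin (greedySeparated E d k) hd
  have hle := measureReal_inter_Iio_greedySeparated_le hbdd hfin hd k
  rw [heq] at hadd
  linarith

theorem greedySeparated_mem_closure {E : Set ℝ} (hne : E.Nonempty) (hbdd : BddBelow E)
    (hfin : volume E ≠ ⊤) {d : ℝ} (hd : 0 ≤ d) {k : ℕ} (hk : k * d < volume.real E) :
    greedySeparated E d k ∈ closure E := by
  cases k with
  | zero => exact csInf_mem_closure hne hbdd
  | succ k =>
    push_cast at hk
    exact closure_mono inter_subset_left (csInf_mem_closure
      (nonempty_inter_Ici_greedySeparated_add hbdd hfin hd hk) (bddBelow_inter_Ici E _))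

theorem greedySeparated_add_le {E : Set ℝ} (hbdd : BddBelow E)
    (hfin : volume E ≠ ⊤) {d : ℝ} (hd : 0 ≤ d) {k : ℕ}
    (hk : (k + 1) * d < volume.real E) :
    greedySeparated E d k + d ≤ greedySeparated E d (k + 1) :=
  le_csInf (nonempty_inter_Ici_greedySeparated_add hbdd hfin hd hk) fun _ hy => hy.2

/-- Existence of `n+1` well-separated points of `closure E` in a measurable set
`E ⊆ [-1/5, 1/5]` of positive measure: consecutive gaps are at least
`|E|/(n+1)`. -/
theorem null_control_stmt_5 (E : Set ℝ) (hE : MeasurableSet E)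
    (hEsub : E ⊆ Set.Icc (-(1 / 5) : ℝ) (1 / 5)) (hpos : 0 < volume E)
    (n : ℕ) (hn : 1 ≤ n) :
    ∃ x : Fin (n + 1) → ℝ, StrictMono x ∧ (∀ i, x i ∈ closure E) ∧
      ∀ i : Fin n, (volume E).toReal / (n + 1) ≤ x i.succ - x i.castSucc := by
  have hbdd : BddBelow E := bddBelow_Icc.mono hEsub
  have hfin : volume E ≠ ⊤ := measure_ne_top_of_subset hEsub measure_Icc_lt_top.ne
  have hne : E.Nonempty := nonempty_of_measure_ne_zero hpos.ne'
  have hV : 0 < volume.real E := ENNReal.toReal_pos hpos.ne' hfin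
  change ∃ x : Fin (n + 1) → ℝ, StrictMono x ∧ (∀ i, x i ∈ closure E) ∧
      ∀ i : Fin n, volume.real E / (n + 1) ≤ x i.succ - x i.castSucc
  set d : ℝ := volume.real E / (n + 1) with hd_def
  have hd : 0 < d := by positivity
  have hmul : (n + 1) * d = volume.real E := by
    rw [hd_def]; field_simp
  have hlt : ∀ k : ℕ, k < n + 1 → k * d < volume.real E := fun k hk => by
    rw [← hmul]
    exact mul_lt_mul_of_pos_right (by exact_mod_cast hk) hd
  have hgap : ∀ i : Fin n, greedySeparated E d i + d ≤ greedySeparated E d (i + 1) := fun i =>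
    greedySeparated_add_le hbdd hfin hd.le
      (by exact_mod_cast hlt (i + 1) (Nat.succ_lt_succ i.isLt))
  refine ⟨fun i => greedySeparated E d i, Fin.strictMono_iff_lt_succ.mpr fun i => ?_,
    fun i => greedySeparated_mem_closure hne hbdd hfin hd.le (hlt i i.isLt), fun i => ?_⟩
  · have := hgap i
    simp only [Fin.val_castSucc, Fin.val_succ]
    linarith
  · have := hgap i
    simp only [Fin.val_castSucc, Fin.val_succ]
    linarith
end

section
/- Let $n \ge 2$, let $x \in \mathbb{R}^n$, and let $E$ be a Lebesgue measurable subset of the closed ball of radius $1$ centered at $x$ with $|E| > 0$. Then there exists a unit vector $z \in S^{n-1}$ such that the one-dimensional Lebesgue measure of the set $\{ t \in [0,1] : x + t z \in E \}$ is at least $|E| / \sigma(S^{n-1})$, where $\sigma(S^{n-1})$ is the total surface measure of the unit sphere $S^{n-1} \subset \mathbb{R}^n$. -/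
open MeasureTheory Set Metric

/-- On a subset of `(0, 1]`, the measure with density `t ^ k` is dominated by Lebesgue measure. -/
theorem volumeIoiPow_le_volume_image (k : ℕ) {s : Set (Ioi (0 : ℝ))} (hs : MeasurableSet s)
    (h : ∀ t ∈ s, t.1 ≤ 1) :
    Measure.volumeIoiPow k s ≤ volume (Subtype.val '' s) := by
  rw [Measure.volumeIoiPow, withDensity_apply _ hs,
    ← comap_subtype_coe_apply measurableSet_Ioi volume s, ← setLIntegral_one]
  refine setLIntegral_mono measurable_const fun t ht => ?_
  rw [ENNReal.ofReal_le_one]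
  exact pow_le_one₀ t.2.out.le (h t ht)

/-- For a positive-measure set `E` inside the closed unit ball centered at `x`
in `ℝⁿ` (`n ≥ 2`), some ray direction `z` on the unit sphere meets `E` in a set
of parameters `t ∈ [0,1]` of one-dimensional measure at least
`|E| / σ(Sⁿ⁻¹)`, where `σ(Sⁿ⁻¹)` is the total surface measure of the unit
sphere, realized here as `Measure.toSphere` of Lebesgue measure. -/
theorem null_control_stmt_14 (n : ℕ) (hn : 2 ≤ n)
    (x : EuclideanSpace ℝ (Fin n)) (E : Set (EuclideanSpace ℝ (Fin n)))
    (hE : MeasurableSet E) (hEsub : E ⊆ Metric.closedBall x 1)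
    (hpos : 0 < volume E) :
    ∃ z : EuclideanSpace ℝ (Fin n), ‖z‖ = 1 ∧
      volume E /
          ((volume : Measure (EuclideanSpace ℝ (Fin n))).toSphere Set.univ) ≤
        volume {t : ℝ | t ∈ Set.Icc (0 : ℝ) 1 ∧ x + t • z ∈ E} := by
  have : Nontrivial (EuclideanSpace ℝ (Fin n)) :=
    Module.nontrivial_of_finrank_pos (R := ℝ) (by rw [finrank_euclideanSpace_fin]; omega)
  set μ : Measure (EuclideanSpace ℝ (Fin n)) := volume
  set F : Set (EuclideanSpace ℝ (Fin n)) := (fun y => x + y) ⁻¹' E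
  have hF : MeasurableSet F := measurable_const_add x hE
  have hvol : μ F = μ E := measure_preimage_add μ x E
  have hfin : μ E ≠ ⊤ := ((measure_mono hEsub).trans_lt measure_closedBall_lt_top).ne
  set e := homeomorphUnitSphereProd (EuclideanSpace ℝ (Fin n))
  set P : Set (sphere (0 : EuclideanSpace ℝ (Fin n)) 1 × Ioi (0 : ℝ)) :=
    e.symm ⁻¹' (Subtype.val ⁻¹' F)
  have hP : MeasurableSet P := e.symm.measurable (measurable_subtype_coe hF)
  have hprod := (μ.measurePreserving_homeomorphUnitSphereProd).measure_preimage
    hP.nullMeasurableSet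
  have hpre : e ⁻¹' P = Subtype.val ⁻¹' F := by
    ext y
    simp [P]
  rw [hpre, comap_subtype_coe_apply (measurableSet_singleton _).compl,
    Subtype.image_preimage_coe, inter_comm, ← sdiff_eq,
    measure_sdiff_null (measure_singleton _), hvol, Measure.prod_apply hP] at hprod
  obtain ⟨z, hz⟩ := exists_laverage_le μ.toSphere_ne_zero (hprod ▸ hfin)
  rw [laverage_eq, ← hprod] at hz
  have hmem : ∀ t ∈ Prod.mk z ⁻¹' P, t.1 ≤ 1 ∧ x + t.1 • z.1 ∈ E := by
    intro t ht
    have hE' : x + t.1 • z.1 ∈ E := ht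
    refine ⟨?_, hE'⟩
    have hb := hEsub hE'
    rwa [mem_closedBall, dist_eq_norm, add_sub_cancel_left, norm_smul,
      norm_eq_of_mem_sphere z, mul_one, Real.norm_of_nonneg t.2.out.le] at hb
  refine ⟨z, norm_eq_of_mem_sphere z, hz.trans ((volumeIoiPow_le_volume_image _
    (measurable_prodMk_left hP) fun t ht => (hmem t ht).1).trans (measure_mono ?_))⟩
  rintro _ ⟨t, ht, rfl⟩
  exact ⟨⟨t.2.out.le, (hmem t ht).1⟩, (hmem t ht).2⟩
end

section
/- Let $0 < \omega_1 \le \omega \le \mu$ and let $a, b \in \mathbb{R}$. Then $e^{-\mu} \left( \dfrac{\sinh \omega_1}{\omega_1} - 1 \right) (a^2 + b^2) \le \int_0^1 \left( a\, e^{\omega y} + b\, e^{-\omega y} \right)^2 dy$. -/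
open MeasureTheory Real

/-- The hyperbolic sine is convex on the nonnegative half-line. -/
theorem convexOn_sinh_Ici : ConvexOn ℝ (Set.Ici 0) Real.sinh := by
  refine MonotoneOn.convexOn_of_deriv (convex_Ici 0) Real.continuous_sinh.continuousOn
    Real.differentiable_sinh.differentiableOn ?_
  rw [Real.deriv_sinh, interior_Ici]
  intro x hx y hy hxy
  exact Real.cosh_le_cosh.2 (by rwa [abs_of_pos hx, abs_of_pos hy])

theorem sinh_div_self_mono {x y : ℝ} (hx : 0 < x) (hxy : x ≤ y) :
    Real.sinh x / x ≤ Real.sinh y / y := by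
  have hy := hx.trans_le hxy
  simpa using convexOn_sinh_Ici.secant_mono (a := 0) (x := x) (y := y)
    Set.self_mem_Ici hx.le hy.le hx.ne' hy.ne' hxy

theorem integral_sq_exp_add_exp_neg {ω : ℝ} (hω : ω ≠ 0) (a b : ℝ) :
    ∫ y in (0 : ℝ)..1, (a * Real.exp (ω * y) + b * Real.exp (-(ω * y))) ^ 2 =
      a ^ 2 * (Real.exp ω * (Real.sinh ω / ω)) + 2 * a * b +
        b ^ 2 * (Real.exp (-ω) * (Real.sinh ω / ω)) := by
  have hderiv : ∀ y ∈ Set.uIcc (0 : ℝ) 1,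
      HasDerivAt (fun y => a ^ 2 / (2 * ω) * Real.exp (ω * y) ^ 2 + 2 * a * b * y -
        b ^ 2 / (2 * ω) * Real.exp (-(ω * y)) ^ 2)
        ((a * Real.exp (ω * y) + b * Real.exp (-(ω * y))) ^ 2) y := by
    intro y _
    have hlin : HasDerivAt (fun y => ω * y) ω y := by
      simpa using (hasDerivAt_id y).const_mul ω
    have hmul : Real.exp (ω * y) * Real.exp (-(ω * y)) = 1 := by
      rw [← Real.exp_add, add_neg_cancel, Real.exp_zero]
    refine HasDerivAt.congr_deriv ((((hlin.exp.pow 2).const_mul (a ^ 2 / (2 * ω))).add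
      ((hasDerivAt_id y).const_mul (2 * a * b))).sub
      ((hlin.neg.exp.pow 2).const_mul (b ^ 2 / (2 * ω)))) ?_
    simp only [Pi.neg_apply, Nat.cast_ofNat, Nat.add_one_sub_one, pow_one]
    field_simp
    linear_combination -2 * a * b * hmul
  rw [intervalIntegral.integral_eq_sub_of_hasDerivAt hderiv
    (Continuous.intervalIntegrable (by fun_prop) _ _)]
  have hmul : Real.exp ω * Real.exp (-ω) = 1 := by
    rw [← Real.exp_add, add_neg_cancel, Real.exp_zero]
  simp only [mul_one, mul_zero, neg_zero, Real.exp_zero, Real.sinh_eq]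
  field_simp
  linear_combination (a ^ 2 - b ^ 2) * hmul

/-- Lower bound (inequality (E: cuarta) of the paper) for the `L²(0,1)` norm of
`a e^{ωy} + b e^{-ωy}` in terms of `a² + b²`, for `0 < ω₁ ≤ ω ≤ μ`. -/
theorem null_control_stmt_15 (ω₁ ω μ a b : ℝ) (h₁ : 0 < ω₁) (h₁ω : ω₁ ≤ ω)
    (hωμ : ω ≤ μ) :
    Real.exp (-μ) * (Real.sinh ω₁ / ω₁ - 1) * (a ^ 2 + b ^ 2) ≤
      ∫ y in (0 : ℝ)..1, (a * Real.exp (ω * y) + b * Real.exp (-(ω * y))) ^ 2 := by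
  have hω : 0 < ω := h₁.trans_le h₁ω
  rw [integral_sq_exp_add_exp_neg hω.ne']
  have hs₁ : 0 ≤ Real.sinh ω₁ / ω₁ - 1 :=
    sub_nonneg.2 ((one_le_div h₁).2 (Real.self_le_sinh_iff.2 h₁.le))
  have hs := sinh_div_self_mono h₁ h₁ω
  have hexp : Real.exp (-μ) ≤ Real.exp (-ω) := Real.exp_le_exp.2 (by linarith)
  have hexp' : Real.exp (-ω) ≤ Real.exp ω := Real.exp_le_exp.2 (by linarith)
  have hmul : Real.exp ω * Real.exp (-ω) = 1 := by
    rw [← Real.exp_add, add_neg_cancel, Real.exp_zero]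
  have hF := Real.exp_pos (-ω)
  set s := Real.sinh ω / ω
  calc Real.exp (-μ) * (Real.sinh ω₁ / ω₁ - 1) * (a ^ 2 + b ^ 2)
      ≤ Real.exp (-ω) * (s - 1) * (a ^ 2 + b ^ 2) := by gcongr
    _ ≤ Real.exp (-ω) * (s - 1) * (a ^ 2 + b ^ 2) +
          (Real.exp (-ω) * (b + Real.exp ω * a) ^ 2 +
            a ^ 2 * ((Real.exp ω - Real.exp (-ω)) * (s - 1))) := by
        have h := mul_nonneg (sub_nonneg.2 hexp') (show 0 ≤ s - 1 by linarith)
        exact le_add_of_nonneg_right (by positivity)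
    _ = _ := by linear_combination (2 * a * b + a ^ 2 * Real.exp ω) * hmul
end
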